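/- arXiv:2408.09036 — 3 statements merged into one kernel-verified Lean document; each statement's English description precedes it below -/
import Mathlib

section
/- Let G be a finite p-group and suppose F_pG = B ⊗ C for subalgebras B and C with B commutative. Then there exist subgroups 𝓑 and 𝓒 of G with G = 𝓑 × 𝓒 (internal direct product), F_p𝓑 ≅ B and F_p𝓒 ≅ C as F_p-algebras. -/
noncomputable section
open MonoidAlgebra
section GA
variable (p : ℕ) [Fact p.Prime] {G : Type*} [Group G]

/-- The group algebra. -/
abbrev GA (p : ℕ) (G : Type*) [Group G] := MonoidAlgebra (ZMod p) G

/-- Embedding of the group. -/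
def emb : G →* GA p G := MonoidAlgebra.of (ZMod p) G

/-- Augmentation. -/
def aug : GA p G →ₐ[ZMod p] ZMod p := MonoidAlgebra.lift (ZMod p) (ZMod p) G 1

@[simp] lemma aug_emb (g : G) : aug p (emb p g) = 1 := by
  simp [aug, emb]

/-- Augmentation ideal, as a subspace. -/
def augI (G : Type*) [Group G] : Submodule (ZMod p) (GA p G) := LinearMap.ker (aug p (G := G)).toLinearMap

lemma mem_augI {x : GA p G} : x ∈ augI p G ↔ aug p x = 0 := by
  simp [augI]

lemma emb_sub_one_mem (g : G) : emb p g - 1 ∈ augI p G := by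
  simp [mem_augI]

lemma ga_induction {P : GA p G → Prop} (h0 : P 0) (hadd : ∀ x y, P x → P y → P (x + y))
    (hs : ∀ (c : ZMod p) (g : G), P (c • emb p g)) (x : GA p G) : P x := by
  induction x using MonoidAlgebra.induction_linear with
  | zero => exact h0
  | add f g hf hg => exact hadd _ _ hf hg
  | single g c => simpa [emb] using hs c g

lemma ga_eq_sum [Fintype G] (x : GA p G) : x = ∑ g, x.coeff g • emb p g := by
  induction x using ga_induction with
  | h0 => simp
  | hadd x y hx hy => 
    conv_lhs => rw [hx, hy]
    simp [add_smul, Finset.sum_add_distrib]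
  | hs c g => 
    classical
    simp [emb, Finsupp.single_apply]

lemma ga_mul_mem {x : GA p G} (hx : x ∈ augI p G) (a : GA p G) : x * a ∈ augI p G := by
  rw [mem_augI] at *; simp [hx]

/-- Square of the augmentation ideal. -/
def augI2 (G : Type*) [Group G] : Submodule (ZMod p) (GA p G) := augI p G * augI p G

lemma augI2_mul_mem {x : GA p G} (hx : x ∈ augI2 p G) (a : GA p G) : x * a ∈ augI2 p G := by
  unfold augI2 at *
  induction hx using Submodule.mul_induction_on' with
  | mem_mul_mem m hm n hn => 
    rw [mul_assoc]
    exact Submodule.mul_mem_mul hm (ga_mul_mem p hn a)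
  | add x _ y _ hx hy => rw [add_mul]; exact add_mem hx hy

lemma augI2_le : augI2 p G ≤ augI p G := by
  unfold augI2
  rw [Submodule.mul_le]
  intro m hm n hn
  exact ga_mul_mem p hm n

lemma map_augI2 {H : Type*} [Group H] (f : GA p G →ₐ[ZMod p] GA p H) (hf : ∀ x, aug p (f x) = aug p x)
    {x : GA p G} (hx : x ∈ augI2 p G) : f x ∈ augI2 p H := by
  unfold augI2 at *
  induction hx using Submodule.mul_induction_on' with
  | mem_mul_mem m hm n hn => 
    rw [map_mul]
    rw [mem_augI] at hm hn
    exact Submodule.mul_mem_mul (by rw [mem_augI, hf, hm]) (by rw [mem_augI, hf, hn])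
  | add x _ y _ hx hy => rw [map_add]; exact add_mem hx hy

/-- `g ↦ g - 1` modulo the square of the augmentation ideal. -/
def dl (g : G) : GA p G ⧸ augI2 p G := (augI2 p G).mkQ (emb p g - 1)

lemma dl_mul (g h : G) : dl p (g * h) = dl p g + dl p h := by
  unfold dl
  rw [← map_add, ← sub_eq_zero, ← map_sub, Submodule.mkQ_apply, Submodule.Quotient.mk_eq_zero]
  have : emb p (g * h) - 1 - (emb p g - 1 + (emb p h - 1)) = (emb p g - 1) * (emb p h - 1) := by
    rw [map_mul]; noncomm_ring
  rw [this]
  exact Submodule.mul_mem_mul (emb_sub_one_mem p g) (emb_sub_one_mem p h)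

/-- `dl` as a hom. -/
def dlHom : G →* Multiplicative (GA p G ⧸ augI2 p G) where
  toFun g := Multiplicative.ofAdd (dl p g)
  map_one' := by simp [dl]
  map_mul' g h := by rw [dl_mul]; rfl

lemma dl_eq (g : G) : dl p g = (dlHom p g).toAdd := rfl

lemma dl_pow (g : G) (n : ℕ) : dl p (g ^ n) = n • dl p g := by
  simp [dl_eq]

lemma dl_inv (g : G) : dl p g⁻¹ = - dl p g := by
  simp [dl_eq]

lemma dl_one : dl p (1 : G) = 0 := by
  simp [dl_eq]

lemma dl_pow_p (g : G) : dl p (g ^ p) = 0 := by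
  rw [dl_pow, ← Nat.cast_smul_eq_nsmul (ZMod p)]
  simp

lemma dl_eq_iff (g h : G) : dl p g = dl p h ↔ emb p g - emb p h ∈ augI2 p G := by
  unfold dl
  rw [← sub_eq_zero, ← map_sub, Submodule.mkQ_apply, Submodule.Quotient.mk_eq_zero]
  simp

/-- Fixed point counting. -/
lemma sum_center [Fintype G] [Fintype (Subgroup.center G)] (hG : IsPGroup p G) {M : Type*} [AddCommGroup M] [Module (ZMod p) M]
    (f : G → M) (hf : ∀ x g, f (x * g * x⁻¹) = f g) :
    ∑ g, f g = ∑ z : Subgroup.center G, f z := by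
  classical
  have h1 := Finset.sum_comp (s := Finset.univ) (f := (id : M → M)) (g := f)
  have h2 : ∑ z : Subgroup.center G, f z = ∑ b ∈ Finset.univ.image f, (Finset.univ.filter (fun z : Subgroup.center G => f z = b)).card • b := by
    refine (Finset.sum_comp (s := Finset.univ) (f := (id : M → M)) (g := fun z : Subgroup.center G => f z)).trans ?_
    apply Finset.sum_subset
    · intro b hb
      simp only [Finset.mem_image, Finset.mem_univ, true_and] at hb ⊢
      obtain ⟨z, hz⟩ := hb
      exact ⟨z, hz⟩
    · intro b _ hb
      simp only [Finset.mem_image, Finset.mem_univ, true_and, not_exists] at hb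
      rw [Finset.filter_false_of_mem (fun z _ => hb z)]
      simp
  rw [h2]
  refine h1.trans (Finset.sum_congr rfl ?_)
  intro b _
  rw [← Nat.cast_smul_eq_nsmul (ZMod p), ← Nat.cast_smul_eq_nsmul (ZMod p)]
  simp only [id]
  congr 1
  rw [ZMod.natCast_eq_natCast_iff]
  let _ : MulAction (ConjAct G) {g : G // f g = b} :=
    { smul := fun x g => ⟨x • g.1, by rw [ConjAct.smul_def, hf]; exact g.2⟩
      one_smul := fun g => Subtype.ext (one_smul _ g.1)
      mul_smul := fun x y g => Subtype.ext (mul_smul x y g.1) }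
  have key := (hG.of_equiv ConjAct.toConjAct).card_modEq_card_fixedPoints {g : G // f g = b}
  have e1 : Nat.card {g : G // f g = b} = (Finset.univ.filter (fun g => f g = b)).card := by
    rw [Nat.card_eq_fintype_card, Fintype.card_subtype]
  have e2 : Nat.card (MulAction.fixedPoints (ConjAct G) {g : G // f g = b}) = (Finset.univ.filter (fun z : Subgroup.center G => f z = b)).card := by
    rw [← Fintype.card_subtype, ← Nat.card_eq_fintype_card]
    refine Nat.card_congr ⟨fun g => ⟨⟨g.1.1, ?_⟩, g.1.2⟩, fun z => ⟨⟨z.1.1, z.2⟩, ?_⟩, fun g => rfl, fun z => rfl⟩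
    · rw [Subgroup.mem_center_iff]
      intro x
      have := congrArg Subtype.val (g.2 (ConjAct.toConjAct x))
      change ConjAct.toConjAct x • g.1.1 = g.1.1 at this
      rw [ConjAct.toConjAct_smul] at this
      rw [mul_inv_eq_iff_eq_mul] at this
      exact this
    · intro x
      apply Subtype.ext
      change x • z.1.1 = z.1.1
      rw [ConjAct.smul_def, Subgroup.mem_center_iff.1 z.1.2, mul_inv_cancel_right]
  rw [e1, e2] at key
  exact key

/-- The central part of an element. -/
def cpart [Fintype (Subgroup.center G)] (b : GA p G) : GA p (Subgroup.center G) :=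
  ∑ z : Subgroup.center G, b.coeff z • emb p z

/-- Inclusion of the group algebra of a subgroup. -/
def gincl (H : Subgroup G) : GA p H →ₐ[ZMod p] GA p G :=
  MonoidAlgebra.mapDomainAlgHom (ZMod p) (ZMod p) H.subtype

lemma gincl_emb (H : Subgroup G) (h : H) : gincl p H (emb p h) = emb p (h : G) := by
  simp [gincl, emb]

lemma coeff_conj {b : GA p G} (hb : ∀ g, Commute (emb p g) b) (x g : G) :
    b.coeff (x * g * x⁻¹) = b.coeff g := by
  have h := congrArg (fun y => y.coeff (x * g)) (hb x)
  simp only [emb, MonoidAlgebra.of_apply] at h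
  rw [MonoidAlgebra.coeff_single_mul_eq_mul_coeff (m₂ := g) (H := by simp)] at h
  rw [MonoidAlgebra.coeff_mul_single_eq_coeff_mul (m₂ := x * g * x⁻¹)
    (H := by intro m _; constructor <;> intro h <;> [rw [← h]; rw [h]] <;> group)] at h
  simpa using h.symm

lemma comm_all {b : GA p G} (hb : ∀ g, Commute (emb p g) b) (y : GA p G) : Commute y b := by
  induction y using ga_induction with
  | h0 => exact Commute.zero_left b
  | hadd x y hx hy => exact hx.add_left hy
  | hs c g => exact (hb g).smul_left c

lemma trace_comm {M : Type*} [AddCommGroup M] [Module (ZMod p) M] (Ψ : GA p G →ₗ[ZMod p] M)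
    (hΨ : ∀ g h, Ψ (emb p (g * h)) = Ψ (emb p (h * g))) (x y : GA p G) : Ψ (x * y) = Ψ (y * x) := by
  induction x using ga_induction with
  | h0 => simp
  | hadd x x' hx hx' => simp [add_mul, mul_add, hx, hx']
  | hs c g =>
    induction y using ga_induction with
    | h0 => simp
    | hadd x x' hx hx' => simp only [add_mul, mul_add, hx, hx', map_add]
    | hs d h =>
      simp only [smul_mul_smul_comm, ← map_mul, map_smul, hΨ g h, mul_comm c d]

lemma trace_cpart [Fintype G] [Fintype (Subgroup.center G)] (hG : IsPGroup p G)
    {M : Type*} [AddCommGroup M] [Module (ZMod p) M] (Ψ : GA p G →ₗ[ZMod p] M)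
    (hΨ : ∀ g h, Ψ (emb p (g * h)) = Ψ (emb p (h * g))) {b b' : GA p G}
    (hb : ∀ g, Commute (emb p g) b) (hb' : ∀ g, Commute (emb p g) b') :
    Ψ (b * b') = Ψ (gincl p _ (cpart p b) * b') := by
  have h1 : Ψ (b * b') = ∑ g, b.coeff g • Ψ (emb p g * b') := by
    conv_lhs => rw [ga_eq_sum p b]
    simp [Finset.sum_mul]
  rw [h1, sum_center p hG]
  · simp [cpart, Finset.sum_mul, gincl_emb]
  · intro x g
    rw [coeff_conj p hb]
    congr 1
    have e : emb p (x * g * x⁻¹) * b' = emb p x * (emb p g * b' * emb p x⁻¹) := by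
      rw [map_mul, map_mul, mul_assoc, mul_assoc, mul_assoc, (hb' _).eq]
    rw [e, trace_comm p Ψ hΨ, mul_assoc, ← map_mul (emb p), inv_mul_cancel, map_one, mul_one]

lemma trace_cpart_pow [Fintype G] [Fintype (Subgroup.center G)] (hG : IsPGroup p G)
    {M : Type*} [AddCommGroup M] [Module (ZMod p) M] (Ψ : GA p G →ₗ[ZMod p] M)
    (hΨ : ∀ g h, Ψ (emb p (g * h)) = Ψ (emb p (h * g))) {b : GA p G}
    (hb : ∀ g, Commute (emb p g) b) (n : ℕ) :
    Ψ (b ^ n) = Ψ ((gincl p _ (cpart p b)) ^ n) := by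
  have hc : ∀ g, Commute (emb p g) (gincl p _ (cpart p b)) := by
    intro g
    simp only [cpart, map_sum, map_smul, gincl_emb]
    refine Commute.sum_right _ _ _ fun z _ => Commute.smul_right ?_ _
    change _ * _ = _ * _
    rw [← map_mul, ← map_mul, Subgroup.mem_center_iff.1 z.2]
  have : ∀ i m, Ψ (b ^ m * (gincl p _ (cpart p b)) ^ i) = Ψ ((gincl p _ (cpart p b)) ^ (m + i)) := by
    intro i m
    induction m generalizing i with
    | zero => simp
    | succ m ih =>
      rw [pow_succ', mul_assoc, trace_cpart p hG Ψ hΨ hb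
        (fun g => ((hb g).pow_right m).mul_right ((hc g).pow_right i)), ← mul_assoc,
        ((comm_all p hb _).pow_right m).eq, mul_assoc, ← pow_succ', ih]
      congr 2; ring
  simpa using this 0 n

lemma sum_pow_comm {R : Type*} [Ring R] [ExpChar R p] {ι : Type*} (s : Finset ι) (f : ι → R)
    (h : ∀ i j, Commute (f i) (f j)) (n : ℕ) : (∑ i ∈ s, f i) ^ p ^ n = ∑ i ∈ s, f i ^ p ^ n := by
  classical
  induction s using Finset.induction_on with
  | empty => simp [(expChar_pos R p).ne']
  | insert a s ha ih =>
    rw [Finset.sum_insert ha, Finset.sum_insert ha, add_pow_expChar_pow_of_commute, ih]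
    exact Commute.sum_right _ _ _ fun i _ => h a i

open scoped IsMulCommutative in
lemma lift_center [Finite G] (hG : IsPGroup p G) {b : GA p G}
    (hb : ∀ g, Commute (emb p g) b) (haug : aug p b = 0) (j : ℕ) (hj : b ^ p ^ j = 0) :
    ∃ z ∈ Subgroup.center G, z ^ p ^ j = 1 ∧ dl p z = (augI2 p G).mkQ b := by
  classical
  have := Fintype.ofFinite G
  -- representatives
  have hrep : ∃ s : G → G, (∀ w, s w ∈ Subgroup.center G) ∧ ∀ z ∈ Subgroup.center G, (s (z ^ p ^ j)) ^ p ^ j = z ^ p ^ j := by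
    refine ⟨fun w => if h : ∃ z ∈ Subgroup.center G, z ^ p ^ j = w then h.choose else 1, ?_, ?_⟩
    · intro w
      dsimp only
      split_ifs with h
      · exact h.choose_spec.1
      · exact one_mem _
    · intro z hz
      have h : ∃ z' ∈ Subgroup.center G, z' ^ p ^ j = z ^ p ^ j := ⟨z, hz, rfl⟩
      dsimp only
      rw [dif_pos h]
      exact h.choose_spec.2
  obtain ⟨s, hsZ, hs⟩ := hrep
  -- linear part
  have hmk : (augI2 p G).mkQ b = ∑ z : Subgroup.center G, b.coeff z • dl p (z : G) := by
    have e : (augI2 p G).mkQ b = ∑ g, b.coeff g • dl p g := by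
      have hb0 : b = ∑ g, b.coeff g • (emb p g - 1) := by
        have h0 : ∑ g, b.coeff g = 0 := by
          rw [ga_eq_sum p b] at haug
          simpa using haug
        simp only [smul_sub, Finset.sum_sub_distrib, ← Finset.sum_smul, h0, zero_smul, sub_zero]
        exact ga_eq_sum p b
      conv_lhs => rw [hb0]
      simp only [map_sum, map_smul, dl]
    rw [e, sum_center p hG]
    intro x g
    rw [coeff_conj p hb, dl_mul, dl_mul, dl_inv]
    congr 1
    abel
  -- the class function
  let ψ : G → GA p G ⧸ augI2 p G := fun g => if g ∈ Subgroup.center G then dl p (s g) else 0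
  let Ψ : GA p G →ₗ[ZMod p] (GA p G ⧸ augI2 p G) := (MonoidAlgebra.basis G (ZMod p)).constr (ZMod p) ψ
  have hΨe : ∀ g, Ψ (emb p g) = ψ g := by
    intro g
    have := (MonoidAlgebra.basis G (ZMod p)).constr_basis (ZMod p) ψ g
    rwa [MonoidAlgebra.basis_apply] at this
  have hΨ : ∀ g h, Ψ (emb p (g * h)) = Ψ (emb p (h * g)) := by
    intro g h
    rw [hΨe, hΨe]
    have aux : ∀ g h : G, g * h ∈ Subgroup.center G → g * h = h * g := by
      intro g h hz
      have := Subgroup.mem_center_iff.1 hz h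
      rw [← mul_assoc] at this
      exact (mul_right_cancel this).symm
    by_cases hz : g * h ∈ Subgroup.center G
    · rw [aux g h hz]
    · by_cases hz' : h * g ∈ Subgroup.center G
      · rw [aux h g hz']
      · simp [ψ, hz, hz']
  have key := trace_cpart_pow p hG Ψ hΨ hb (p ^ j)
  rw [hj, map_zero, ← map_pow] at key
  have : CharP (GA p (Subgroup.center G)) p := charP_of_injective_algebraMap (algebraMap (ZMod p) (GA p (Subgroup.center G))).injective p
  have hpow : cpart p b ^ p ^ j = ∑ z : Subgroup.center G, b.coeff z • emb p (z ^ p ^ j) := by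
    unfold cpart
    have hcm : ∀ i j : Subgroup.center G, Commute (emb p i) (emb p j) := fun i j => by
      change _ * _ = _ * _
      rw [← map_mul, ← map_mul, mul_comm]
    rw [sum_pow_comm p _ _ (fun i j => ((hcm i j).smul_left _).smul_right _)]
    refine Finset.sum_congr rfl fun z _ => ?_
    rw [smul_pow, map_pow]
    congr 1
    exact ZMod.pow_card_pow _
  rw [hpow] at key
  simp only [map_sum, map_smul, gincl_emb, hΨe] at key
  have key2 : ∑ z : Subgroup.center G, b.coeff z • dl p (s ((z : G) ^ p ^ j)) = 0 := by
    rw [key]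
    refine Finset.sum_congr rfl fun z _ => ?_
    have : ((z ^ p ^ j : Subgroup.center G) : G) ∈ Subgroup.center G := (z ^ p ^ j).2
    simp only [ψ, if_pos this]
    simp
  -- the element
  let z0 : Subgroup.center G := ∏ z : Subgroup.center G, (z * (⟨s ((z : G) ^ p ^ j), hsZ _⟩ : Subgroup.center G)⁻¹) ^ (b.coeff z).val
  refine ⟨z0, z0.2, ?_, ?_⟩
  · have : z0 ^ p ^ j = 1 := by
      simp only [z0]
      rw [← Finset.prod_pow]
      refine Finset.prod_eq_one fun z _ => ?_
      rw [pow_right_comm, mul_pow, inv_pow]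
      have h2 : (⟨s ((z : G) ^ p ^ j), hsZ _⟩ : Subgroup.center G) ^ p ^ j = z ^ p ^ j := by
        apply Subtype.ext
        simpa using hs z z.2
      rw [h2, mul_inv_cancel, one_pow]
    have h3 := congrArg Subtype.val this
    simpa using h3
  · rw [hmk]
    have : ∀ z : Subgroup.center G, dl p (z : G) = (((dlHom p).comp (Subgroup.center G).subtype) z).toAdd := fun z => rfl
    rw [this z0]
    simp only [z0]
    rw [map_prod, toAdd_prod]
    have : ∀ z : Subgroup.center G, Multiplicative.toAdd (((dlHom p).comp (Subgroup.center G).subtype) ((z * (⟨s ((z : G) ^ p ^ j), hsZ _⟩ : Subgroup.center G)⁻¹) ^ (b.coeff z).val)) = b.coeff z • dl p (z : G) - b.coeff z • dl p (s ((z : G) ^ p ^ j)) := by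
      intro z
      rw [map_pow, toAdd_pow, ← Nat.cast_smul_eq_nsmul (ZMod p), ZMod.natCast_zmod_val, ← smul_sub, map_mul, map_inv, toAdd_mul, toAdd_inv, ← sub_eq_add_neg]
      rfl
    simp only [this]
    rw [Finset.sum_sub_distrib, key2, sub_zero]

end GA

section Nilp
variable (p : ℕ) [Fact p.Prime] {G : Type*} [Group G]

instance ga_finite [Finite G] : Finite (GA p G) :=
  Module.finite_of_finite (ZMod p) (M := GA p G)

lemma augI_nilp [Finite G] (hG : IsPGroup p G) : ∃ k, (augI p G) ^ k = ⊥ := by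
  let P : Submodule (GA p G) (GA p G) → Prop := fun J => ∃ k, ∀ x ∈ (augI p G) ^ k, ∀ a ∈ J, x * a = 0
  have : Finite (Submodule (GA p G) (GA p G)) := Finite.of_injective (fun J => (J : Set (GA p G))) SetLike.coe_injective
  obtain ⟨J, hJP, hJ⟩ := (Set.toFinite {J | P J}).exists_maximal ⟨⊥, 0, by simp⟩
  obtain ⟨k, hk⟩ := hJP
  have htop : J = ⊤ := by
    by_contra hne
    have hnt : Nontrivial (GA p G ⧸ J) := Submodule.Quotient.nontrivial_iff.2 hne
    have hfin : Finite (GA p G ⧸ J) := Finite.of_surjective _ (Submodule.mkQ_surjective J)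
    have hfin2 : Finite (Multiplicative (GA p G ⧸ J)) := hfin
    let _ : MulAction G (GA p G ⧸ J) := MulAction.compHom _ (emb p (G := G))
    have hsm : ∀ (g : G) (m : GA p G ⧸ J), g • m = emb p g • m := fun _ _ => rfl
    have hQ : IsPGroup p (Multiplicative (GA p G ⧸ J)) := by
      intro m
      refine ⟨1, ?_⟩
      rw [pow_one]
      apply Multiplicative.toAdd.injective
      rw [toAdd_pow, ← Nat.cast_smul_eq_nsmul (ZMod p)]
      simp
    have hdvd : p ∣ Nat.card (GA p G ⧸ J) := by
      rcases hQ.card_eq_or_dvd with h | h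
      · exfalso
        have : 1 < Nat.card (Multiplicative (GA p G ⧸ J)) := Finite.one_lt_card
        omega
      · exact h
    obtain ⟨q, hq, hq0⟩ := hG.exists_fixed_point_of_prime_dvd_card_of_fixed_point _ hdvd
      (a := (0 : GA p G ⧸ J)) (fun g => by rw [hsm, smul_zero])
    obtain ⟨a, rfl⟩ := Submodule.mkQ_surjective J q
    have ha : a ∉ J := fun h => hq0 (by simpa using ((Submodule.Quotient.mk_eq_zero J).2 h).symm)
    have hfix : ∀ y : GA p G, y * a - aug p y • a ∈ J := by
      intro y
      induction y using ga_induction with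
      | h0 => simp
      | hadd x y hx hy =>
        have := add_mem hx hy
        simpa only [add_mul, map_add, add_smul, add_sub_add_comm] using this
      | hs c g =>
        have h1 := hq g
        rw [hsm, ← map_smul, ← sub_eq_zero, ← map_sub, Submodule.mkQ_apply, Submodule.Quotient.mk_eq_zero] at h1
        have h2 := J.smul_mem (algebraMap (ZMod p) (GA p G) c) h1
        rw [algebraMap_smul] at h2
        simpa [smul_sub, smul_mul_assoc] using h2
    have hI : ∀ x ∈ augI p G, x * a ∈ J := by
      intro x hx
      have := hfix x
      rw [mem_augI] at hx
      simpa [hx] using this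
    have hle : J ⊔ Submodule.span _ {a} ≤ J := by
      refine hJ ?_ le_sup_left
      refine ⟨k + 1, ?_⟩
      intro x hx b hb
      rw [Submodule.mem_sup] at hb
      obtain ⟨j, hj, c, hc, rfl⟩ := hb
      obtain ⟨y, rfl⟩ := Submodule.mem_span_singleton.1 hc
      rw [pow_succ] at hx
      induction hx using Submodule.mul_induction_on' with
      | mem_mul_mem m hm n hn =>
        rw [mul_assoc]
        refine hk m hm _ ?_
        rw [mul_add]
        refine add_mem (J.smul_mem n hj) ?_
        rw [smul_eq_mul, ← mul_assoc]
        exact hI _ (ga_mul_mem p hn y)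
      | add x _ y _ hx hy => rw [add_mul, hx, hy, add_zero]
    exact ha (hle (Submodule.mem_sup_right (Submodule.mem_span_singleton_self a)))
  refine ⟨k, ?_⟩
  rw [eq_bot_iff]
  intro x hx
  have := hk x hx 1 (by rw [htop]; trivial)
  simpa using this

lemma subalg_top [Finite G] (hG : IsPGroup p G) (S : Subalgebra (ZMod p) (GA p G))
    (h : ∀ g : G, ∃ s ∈ S, emb p g - s ∈ augI2 p G) : S = ⊤ := by
  have h1 : ∀ y : GA p G, ∃ s ∈ S, y - s ∈ augI2 p G := by
    intro y
    induction y using ga_induction with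
    | h0 => exact ⟨0, zero_mem _, by simp⟩
    | hadd x y hx hy =>
      obtain ⟨s, hs, hs'⟩ := hx
      obtain ⟨t, ht, ht'⟩ := hy
      refine ⟨s + t, add_mem hs ht, ?_⟩
      rw [add_sub_add_comm]; exact add_mem hs' ht'
    | hs c g =>
      obtain ⟨s, hs, hs'⟩ := h g
      refine ⟨c • s, S.smul_mem hs c, ?_⟩
      rw [← smul_sub]; exact Submodule.smul_mem _ _ hs'
  let I := augI p G
  let T : Submodule (ZMod p) (GA p G) := Subalgebra.toSubmodule S ⊓ I
  have hTI : T ≤ I := inf_le_right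
  have hII : I * I ≤ I := augI2_le p
  have hIT : I ≤ T ⊔ I ^ 2 := by
    intro x hx
    obtain ⟨s, hs, hs'⟩ := h1 x
    rw [Submodule.mem_sup]
    refine ⟨s, ⟨hs, ?_⟩, x - s, by rw [pow_two]; exact hs', by abel⟩
    have := sub_mem hx (augI2_le p hs')
    simpa using this
  have hTT : T * T ≤ T := by
    rw [Submodule.mul_le]
    intro a ha b hb
    exact ⟨S.mul_mem ha.1 hb.1, ga_mul_mem p ha.2 b⟩
  have hTk : ∀ k, T ^ (k + 1) ≤ T := by
    intro k
    induction k with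
    | zero => simp
    | succ k ih => rw [pow_succ]; exact (mul_le_mul' ih le_rfl).trans hTT
  have step : ∀ k, I ^ (k + 1) ≤ T ^ (k + 1) ⊔ I ^ (k + 2) := by
    intro k
    induction k with
    | zero => simpa using hIT
    | succ k ih =>
      have e1 : I ^ (k + 1 + 1) ≤ (T ^ (k + 1) ⊔ I ^ (k + 2)) * (T ⊔ I ^ 2) := by
        rw [pow_succ]; exact mul_le_mul' ih hIT
      refine e1.trans ?_
      rw [Submodule.sup_mul, Submodule.mul_sup, Submodule.mul_sup]
      have hpw : T ^ (k + 1) ≤ I ^ (k + 1) := by gcongr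
      refine sup_le (sup_le ?_ ?_) (sup_le ?_ ?_)
      · rw [← pow_succ]; exact le_sup_left
      · refine le_sup_of_le_right ?_
        refine (mul_le_mul' hpw le_rfl).trans ?_
        rw [← pow_add]
      · refine le_sup_of_le_right ?_
        rw [pow_succ I (k + 2)]
        exact mul_le_mul' le_rfl hTI
      · refine le_sup_of_le_right ?_
        rw [pow_succ I (k + 2), pow_two]
        exact mul_le_mul' le_rfl hII
  have hk : ∀ k, I ≤ T ⊔ I ^ (k + 1) := by
    intro k
    induction k with
    | zero => simp
    | succ k ih => exact ih.trans (sup_le le_sup_left ((step k).trans (sup_le_sup_right (hTk k) _)))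
  obtain ⟨k, hk0⟩ := augI_nilp p hG
  have hIS : I ≤ T := by
    have := hk k
    rw [pow_succ, hk0] at this
    simpa using this
  rw [eq_top_iff]
  intro x _
  have hx : x - algebraMap (ZMod p) _ (aug p x) ∈ I := by
    change _ ∈ augI p G
    rw [mem_augI, map_sub, AlgHom.commutes]; simp
  have := add_mem (hIS hx).1 (S.algebraMap_mem (aug p x))
  simpa using this

end Nilp

section Grp
variable (p : ℕ) [Fact p.Prime] {G : Type*} [Group G]

lemma exists_char [Finite G] (z : G) (n : ℕ)
    (h : ∀ y : G, z ^ p ^ n * y ^ p ^ (n + 1) ∉ commutator G) :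
    ∃ f : G →* ℂˣ, f z ^ p ^ n ≠ 1 ∧ ∀ g, f g ^ p ^ (n + 1) = 1 := by
  let Q := Abelianization G
  let P : Subgroup Q := (powMonoidHom (p ^ (n + 1)) : Q →* Q).range
  have hne : (QuotientGroup.mk (Abelianization.of (z ^ p ^ n)) : Q ⧸ P) ≠ 1 := by
    rw [Ne, QuotientGroup.eq_one_iff]
    rintro ⟨y, hy⟩
    obtain ⟨y, rfl⟩ : ∃ y', Abelianization.of y' = y := QuotientGroup.mk_surjective y
    apply h y⁻¹
    rw [← Abelianization.ker_of, MonoidHom.mem_ker, map_mul, ← hy]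
    rw [powMonoidHom_apply, map_pow, map_inv, inv_pow, mul_inv_cancel]
  have : Finite Q := Finite.of_surjective _ (QuotientGroup.mk_surjective)
  obtain ⟨φ, hφ⟩ := CommGroup.exists_apply_ne_one_of_hasEnoughRootsOfUnity (Q ⧸ P) ℂ hne
  refine ⟨φ.comp ((QuotientGroup.mk' P).comp Abelianization.of), ?_, ?_⟩
  · rw [← map_pow]; exact hφ
  · intro g
    rw [← map_pow]
    change φ (QuotientGroup.mk (Abelianization.of (g ^ p ^ (n + 1)))) = 1
    have : (QuotientGroup.mk (Abelianization.of (g ^ p ^ (n + 1))) : Q ⧸ P) = 1 := by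
      rw [QuotientGroup.eq_one_iff]
      exact ⟨Abelianization.of g, by simp⟩
    rw [this, map_one]

lemma group_split [Finite G] (hG : IsPGroup p G) (K W : Subgroup G) (hKp : ∀ y : G, y ^ p ∈ K)
    (hKW : K ≤ W)
    (h2 : ∀ g ∈ W, ∀ j, g ^ p ^ j ∈ commutator G →
      ∃ z ∈ Subgroup.center G, z ^ p ^ j = 1 ∧ z⁻¹ * g ∈ K) :
    ∃ B C : Subgroup G, B ≤ Subgroup.center G ∧ Disjoint B C ∧ B ⊔ C = ⊤ ∧ B ≤ W ∧
      ∀ w ∈ W, ∃ h ∈ B, h⁻¹ * w ∈ K := by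
  classical
  let P : Subgroup G → Prop := fun B => B ≤ Subgroup.center G ∧ B ≤ W ∧ ∃ C, Disjoint B C ∧ B ⊔ C = ⊤
  obtain ⟨B, hBP, hmax⟩ := (Set.toFinite {B | P B}).exists_maximal
    ⟨⊥, bot_le, bot_le, ⊤, disjoint_bot_left, by simp⟩
  obtain ⟨hBZ, hBW, C, hdis, hsup⟩ := hBP
  refine ⟨B, C, hBZ, hdis, hsup, hBW, ?_⟩
  by_contra! hcon
  obtain ⟨w, hwW, hw⟩ := hcon
  have hBn : B.Normal := ⟨fun b hb g => by
    rw [Subgroup.mem_center_iff.1 (hBZ hb), mul_inv_cancel_right]; exact hb⟩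
  let Q : ℕ → Prop := fun n => ∃ z ∈ Subgroup.center G, z ^ p ^ n = 1 ∧ z ∈ W ∧ ∀ h ∈ B, h⁻¹ * z ∉ K
  -- transfer along K
  have htr : ∀ z g : G, z⁻¹ * g ∈ K → g ∈ W → (∀ h ∈ B, h⁻¹ * g ∉ K) → z ∈ W ∧ ∀ h ∈ B, h⁻¹ * z ∉ K := by
    intro z g hzg hg hh
    refine ⟨?_, fun h hB hK => hh h hB ?_⟩
    · have := W.mul_mem hg (W.inv_mem (hKW hzg))
      simpa using this
    · have := K.mul_mem hK hzg
      simpa [mul_assoc] using this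
  have hQ : ∃ n, Q n := by
    obtain ⟨j, hj⟩ := hG w
    obtain ⟨z, hz, hzj, hzK⟩ := h2 w hwW j (by rw [hj]; exact one_mem _)
    exact ⟨j, z, hz, hzj, htr z w hzK hwW hw⟩
  obtain ⟨n, hn, hmin⟩ : ∃ n, Q n ∧ ∀ m < n, ¬ Q m := ⟨Nat.find hQ, Nat.find_spec hQ, fun m hm => Nat.find_min hQ hm⟩
  obtain ⟨z₁, hz₁Z, hz₁p, hz₁W, hz₁⟩ := hn
  -- project to C
  obtain ⟨h₀, hh₀, z, hzC, hz₀⟩ : ∃ h ∈ B, ∃ c ∈ C, h * c = z₁ := by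
    have : z₁ ∈ B ⊔ C := by rw [hsup]; trivial
    rw [Subgroup.mem_sup_of_normal_left] at this
    obtain ⟨b, hb, c, hc, e⟩ := this
    exact ⟨b, hb, c, hc, e⟩
  have hzeq : z = h₀⁻¹ * z₁ := by rw [← hz₀]; group
  have hzZ : z ∈ Subgroup.center G := by
    rw [hzeq]; exact mul_mem (inv_mem (hBZ hh₀)) hz₁Z
  have hzp : z ^ p ^ n = 1 := by
    have hcm : Commute h₀ z := (Subgroup.mem_center_iff.1 hzZ h₀)
    have e : h₀ ^ p ^ n * z ^ p ^ n = 1 := by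
      rw [← hcm.mul_pow, hz₀, hz₁p]
    have e2 : z ^ p ^ n = (h₀ ^ p ^ n)⁻¹ := (inv_eq_of_mul_eq_one_right e).symm
    have := Subgroup.disjoint_def.1 hdis (x := z ^ p ^ n) (by rw [e2]; exact inv_mem (pow_mem hh₀ _)) (pow_mem hzC _)
    exact this
  have hzW : z ∈ W := by rw [hzeq]; exact mul_mem (inv_mem (hBW hh₀)) hz₁W
  have hzK : ∀ h ∈ B, h⁻¹ * z ∉ K := by
    intro h hh
    have := hz₁ (h₀ * h) (mul_mem hh₀ hh)
    rwa [mul_inv_rev, mul_assoc, ← hzeq] at this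
  obtain ⟨m, rfl⟩ : ∃ m, n = m + 1 := by
    rcases n with _ | m
    · exfalso
      apply hzK 1 (one_mem _)
      have : z = 1 := by simpa using hzp
      simp [this, K.one_mem]
    · exact ⟨m, rfl⟩
  obtain ⟨f, hf1, hf2⟩ := exists_char p z m (by
    intro y hy
    apply hmin m (Nat.lt_succ_self m)
    have hcm : Commute z (y ^ p) := (Subgroup.mem_center_iff.1 hzZ (y ^ p)).symm
    obtain ⟨z', hz'Z, hz'p, hz'K⟩ := h2 (z * y ^ p) (mul_mem hzW (hKW (hKp y))) m (by
      rw [hcm.mul_pow, ← pow_mul, ← pow_succ']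
      exact hy)
    refine ⟨z', hz'Z, hz'p, htr z' _ hz'K (mul_mem hzW (hKW (hKp y))) ?_⟩
    intro h hh hK
    apply hzK h hh
    have := K.mul_mem hK (K.inv_mem (hKp y))
    simpa [mul_assoc] using this)
  have hord : orderOf (f z) = p ^ (m + 1) := orderOf_eq_prime_pow hf1 (hf2 z)
  have hprim : IsPrimitiveRoot ((f z : ℂˣ) : ℂ) (p ^ (m + 1)) := by
    rw [IsPrimitiveRoot.coe_units_iff, ← hord]; exact IsPrimitiveRoot.orderOf _
  have hp0 : NeZero (p ^ (m + 1)) := ⟨pow_ne_zero _ (Fact.out : p.Prime).ne_zero⟩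
  have hzB : z ∈ B := by
    refine hmax (y := B ⊔ Subgroup.zpowers z) ?_ le_sup_left (Subgroup.mem_sup_right (Subgroup.mem_zpowers z))
    have hzz : Subgroup.zpowers z ≤ Subgroup.center G := by rwa [Subgroup.zpowers_le]
    refine ⟨sup_le hBZ hzz, sup_le hBW (by rwa [Subgroup.zpowers_le]), C ⊓ f.ker, ?_, ?_⟩
    · rw [Subgroup.disjoint_def]
      intro x hx hxC
      rw [Subgroup.mem_sup_of_normal_left] at hx
      obtain ⟨b, hb, c, hc, rfl⟩ := hx
      obtain ⟨k, rfl⟩ := Subgroup.mem_zpowers_iff.1 hc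
      obtain ⟨hxC, hxf⟩ := hxC
      have hbC : b ∈ C := by
        have hxC : b * z ^ k ∈ C := hxC
        have := C.mul_mem hxC (C.inv_mem (C.zpow_mem hzC k))
        simpa using this
      have hb1 := Subgroup.disjoint_def.1 hdis hb hbC
      subst hb1
      have hxf : f (1 * z ^ k) = 1 := hxf
      rw [one_mul, map_zpow, ← orderOf_dvd_iff_zpow_eq_one, hord] at hxf
      rw [one_mul, ← orderOf_dvd_iff_zpow_eq_one]
      exact (Int.natCast_dvd_natCast.2 (orderOf_dvd_of_pow_eq_one hzp)).trans hxf
    · rw [eq_top_iff]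
      intro g _
      have hg : g ∈ B ⊔ C := by rw [hsup]; trivial
      rw [Subgroup.mem_sup_of_normal_left] at hg
      obtain ⟨b, hb, c, hc, rfl⟩ := hg
      obtain ⟨i, -, hi⟩ := hprim.eq_pow_of_pow_eq_one (ξ := ((f c : ℂˣ) : ℂ)) (by
        rw [← Units.val_pow_eq_pow_val, hf2]; rfl)
      have hi : f z ^ i = f c := Units.ext (by simpa using hi)
      refine mul_mem (Subgroup.mem_sup_left (Subgroup.mem_sup_left hb)) ?_
      have : c = z ^ i * ((z ^ i)⁻¹ * c) := by group
      rw [this]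
      refine mul_mem (Subgroup.mem_sup_left (Subgroup.mem_sup_right (pow_mem (Subgroup.mem_zpowers z) i))) ?_
      refine Subgroup.mem_sup_right (Subgroup.mem_inf.2 ⟨C.mul_mem (C.inv_mem (C.pow_mem hzC i)) hc, ?_⟩)
      change f _ = 1
      rw [map_mul, map_inv, map_pow, hi, inv_mul_cancel]
  apply hzK z hzB
  simp [K.one_mem]

end Grp

section Gen
open scoped TensorProduct
variable (R B C : Type*) [CommRing R] [Ring B] [Ring C] [Algebra R B] [Algebra R C]

lemma tens_right (φ : C →ₐ[R] R) : ∃ r : B ⊗[R] C →ₐ[R] B, ∀ b c, r (b ⊗ₜ c) = φ c • b := by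
  have hc : ∀ (x : B) (y : C), Commute ((AlgHom.id R B) x) (((Algebra.ofId R B).comp φ) y) :=
    fun x y => (Algebra.commutes _ _).symm
  refine ⟨Algebra.TensorProduct.lift (AlgHom.id R B) ((Algebra.ofId R B).comp φ) hc, ?_⟩
  intro b c
  rw [Algebra.TensorProduct.lift_tmul, Algebra.smul_def, Algebra.commutes]
  rfl

lemma tens_left (φ : B →ₐ[R] R) : ∃ r : B ⊗[R] C →ₐ[R] C, ∀ b c, r (b ⊗ₜ c) = φ b • c := by
  have hc : ∀ (x : B) (y : C), Commute (((Algebra.ofId R C).comp φ) x) ((AlgHom.id R C) y) :=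
    fun x y => Algebra.commutes _ _
  refine ⟨Algebra.TensorProduct.lift ((Algebra.ofId R C).comp φ) (AlgHom.id R C) hc, ?_⟩
  intro b c
  rw [Algebra.TensorProduct.lift_tmul, Algebra.smul_def]
  rfl

end Gen

section Fin
variable (p : ℕ) [Fact p.Prime] {G : Type*} [Group G]

open scoped TensorProduct in
lemma tensor_equiv (B C : Subalgebra (ZMod p) (GA p G))
    (hcomm : ∀ b ∈ B, ∀ c ∈ C, Commute b c)
    (hmul : Function.Bijective
      (Submodule.mulMap (Subalgebra.toSubmodule B) (Subalgebra.toSubmodule C))) :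
    ∃ e : (B ⊗[ZMod p] C) ≃ₐ[ZMod p] GA p G, ∀ (b : B) (c : C), e (b ⊗ₜ c) = b * c := by
  have hc : ∀ (x : B) (y : C), Commute (B.val x) (C.val y) := fun x y => hcomm x x.2 y y.2
  have he0 : Function.Bijective (Algebra.TensorProduct.lift B.val C.val hc) := by
    have h1 : (Algebra.TensorProduct.lift B.val C.val hc).toLinearMap = Submodule.mulMap (Subalgebra.toSubmodule B) (Subalgebra.toSubmodule C) := by
      apply TensorProduct.ext'
      intro x y
      rw [AlgHom.toLinearMap_apply, Algebra.TensorProduct.lift_tmul]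
      exact (Submodule.mulMap_tmul (Subalgebra.toSubmodule B) (Subalgebra.toSubmodule C) x y).symm
    have h2 := congrArg DFunLike.coe h1
    rw [AlgHom.coe_toLinearMap] at h2
    rw [h2]; exact hmul
  refine ⟨AlgEquiv.ofBijective _ he0, fun b c => ?_⟩
  rw [AlgEquiv.coe_ofBijective, Algebra.TensorProduct.lift_tmul]
  rfl

open scoped TensorProduct in
lemma rho_sigma_aux (B C : Subalgebra (ZMod p) (GA p G))
    (e : (B ⊗[ZMod p] C) ≃ₐ[ZMod p] GA p G) (he : ∀ (b : B) (c : C), e (b ⊗ₜ c) = b * c) :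
    ∃ ρ σ : GA p G →ₐ[ZMod p] GA p G, (∀ x, ρ x ∈ B) ∧ (∀ x, σ x ∈ C) ∧
      (∀ b ∈ B, ∀ c ∈ C, ρ (b * c) = aug p c • b) ∧
      (∀ b ∈ B, ∀ c ∈ C, σ (b * c) = aug p b • c) := by
  have hes : ∀ b (hb : b ∈ B) c (hc : c ∈ C), e.symm (b * c) = (⟨b, hb⟩ : B) ⊗ₜ (⟨c, hc⟩ : C) := by
    intro b hb c hc
    rw [AlgEquiv.symm_apply_eq, he]
  obtain ⟨r, hr⟩ := tens_right (ZMod p) B C ((aug p).comp C.val)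
  obtain ⟨s, hs⟩ := tens_left (ZMod p) B C ((aug p).comp B.val)
  refine ⟨B.val.comp (r.comp (e.symm : GA p G →ₐ[ZMod p] B ⊗[ZMod p] C)), C.val.comp (s.comp (e.symm : GA p G →ₐ[ZMod p] B ⊗[ZMod p] C)), fun x => Subtype.prop _, fun x => Subtype.prop _, ?_, ?_⟩
  · intro b hb c hc
    rw [AlgHom.comp_apply, AlgHom.comp_apply, AlgEquiv.coe_toAlgHom, hes b hb c hc, hr]
    rfl
  · intro b hb c hc
    rw [AlgHom.comp_apply, AlgHom.comp_apply, AlgEquiv.coe_toAlgHom, hes b hb c hc, hs]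
    rfl

open scoped TensorProduct in
lemma rho_sigma (B C : Subalgebra (ZMod p) (GA p G))
    (hcomm : ∀ b ∈ B, ∀ c ∈ C, Commute b c)
    (hmul : Function.Bijective
      (Submodule.mulMap (Subalgebra.toSubmodule B) (Subalgebra.toSubmodule C))) :
    ∃ ρ σ : GA p G →ₐ[ZMod p] GA p G, (∀ x, ρ x ∈ B) ∧ (∀ x, σ x ∈ C) ∧
      (∀ x, aug p (ρ x) = aug p x) ∧ (∀ x, aug p (σ x) = aug p x) ∧ (∀ x, ρ (ρ x) = ρ x) ∧
      (∀ x, x - ρ x - σ x + algebraMap _ _ (aug p x) ∈ augI2 p G) ∧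
      (∀ b ∈ B, (∀ b' ∈ B, Commute b' b) → ∀ x, Commute x b) ∧
      Module.finrank (ZMod p) B * Module.finrank (ZMod p) C = Module.finrank (ZMod p) (GA p G) := by
  obtain ⟨e, he⟩ := tensor_equiv p B C hcomm hmul
  obtain ⟨ρ, σ, hρB, hσC, hρ, hσ⟩ := rho_sigma_aux p B C e he
  have hind : ∀ P : GA p G → Prop, P 0 → (∀ x y, P x → P y → P (x + y)) →
      (∀ b ∈ B, ∀ c ∈ C, P (b * c)) → ∀ x, P x := by
    intro P h0 ha hm x
    obtain ⟨t, rfl⟩ := e.surjective x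
    induction t using TensorProduct.induction_on with
    | zero => rw [map_zero]; exact h0
    | tmul b c => rw [he]; exact hm b b.2 c c.2
    | add x y hx hy => rw [map_add]; exact ha _ _ hx hy
  refine ⟨ρ, σ, hρB, hσC, ?_, ?_, ?_, ?_, ?_, ?_⟩
  · apply hind
    · simp
    · intro x y hx hy; simp [hx, hy]
    · intro b hb c hc; rw [hρ b hb c hc]; simp [mul_comm]
  · apply hind
    · simp
    · intro x y hx hy; simp [hx, hy]
    · intro b hb c hc; rw [hσ b hb c hc]; simp
  · intro x
    have := hρ (ρ x) (hρB x) 1 C.one_mem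
    simpa using this
  · apply hind
    · simp
    · intro x y hx hy
      have := add_mem hx hy
      convert this using 1
      rw [map_add, map_add, map_add, map_add]; abel
    · intro b hb c hc
      rw [hρ b hb c hc, hσ b hb c hc]
      have h1 : b - algebraMap _ _ (aug p b) ∈ augI p G := by
        rw [mem_augI, map_sub, AlgHom.commutes]; simp
      have h2 : c - algebraMap _ _ (aug p c) ∈ augI p G := by
        rw [mem_augI, map_sub, AlgHom.commutes]; simp
      have h3 := Submodule.mul_mem_mul h1 h2
      unfold augI2
      convert h3 using 1
      rw [sub_mul, mul_sub, mul_sub, Algebra.smul_def, Algebra.smul_def, map_mul, map_mul,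
        Algebra.commutes (aug p c) b]
      abel
  · intro b hb hbb
    apply hind
    · exact Commute.zero_left b
    · intro x y hx hy; exact hx.add_left hy
    · intro b' hb' c hc
      exact (hbb b' hb').mul_left (hcomm b hb c hc).symm
  · rw [← e.toLinearEquiv.finrank_eq, Module.finrank_tensorProduct]

end Fin

section Last
variable (p : ℕ) [Fact p.Prime] {G : Type*} [Group G]

/-- Map on group algebras. -/
def gmap {H : Type*} [Group H] (π : G →* H) : GA p G →ₐ[ZMod p] GA p H :=
  MonoidAlgebra.mapDomainAlgHom (ZMod p) (ZMod p) π

lemma gmap_emb {H : Type*} [Group H] (π : G →* H) (g : G) : gmap p π (emb p g) = emb p (π g) := by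
  simp [gmap, emb]

lemma aug_gmap {H : Type*} [Group H] (π : G →* H) (x : GA p G) : aug p (gmap p π x) = aug p x := by
  induction x using ga_induction with
  | h0 => simp
  | hadd x y hx hy => simp [hx, hy]
  | hs c g => simp [gmap_emb]

lemma finrank_ga (G : Type*) [Group G] [Finite G] :
    Module.finrank (ZMod p) (GA p G) = Nat.card G :=
  Module.finrank_eq_nat_card_basis (MonoidAlgebra.basis G (ZMod p))

lemma sub_one_pow {x : GA p G} (n : ℕ) : (x - 1) ^ p ^ n = x ^ p ^ n - 1 := by
  have : CharP (GA p G) p := charP_of_injective_algebraMap (algebraMap (ZMod p) (GA p G)).injective p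
  have : ExpChar (GA p G) p := ExpChar.prime Fact.out
  have := sub_pow_expChar_pow_of_commute (p := p) (n := n) (Commute.one_right x)
  rw [this, one_pow]

lemma exists_proj (B C : Subgroup G) (hBZ : B ≤ Subgroup.center G) (hd : Disjoint B C) (hs : B ⊔ C = ⊤) :
    ∃ (πB : G →* B) (πC : G →* C), (∀ b : B, πB b = b) ∧ (∀ c : C, πC c = c) ∧
      (∀ b : B, πC b = 1) ∧ (∀ c : C, πB c = 1) ∧ Nat.card G = Nat.card B * Nat.card C := by
  have hcm : ∀ (b : B) (c : C), Commute (B.subtype b) (C.subtype c) := fun b c =>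
    (Subgroup.mem_center_iff.1 (hBZ b.2) c).symm
  have hbij : Function.Bijective (MonoidHom.noncommCoprod B.subtype C.subtype hcm) := by
    constructor
    · rw [injective_iff_map_eq_one]
      rintro ⟨b, c⟩ h
      rw [MonoidHom.noncommCoprod_apply] at h
      have h : (b : G) * c = 1 := h
      have hb : (b : G) ∈ C := by
        rw [eq_inv_of_mul_eq_one_left h]; exact C.inv_mem c.2
      have hb1 := Subgroup.disjoint_def.1 hd b.2 hb
      rw [hb1, one_mul] at h
      exact Prod.ext (Subtype.ext hb1) (Subtype.ext h)
    · intro g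
      have : g ∈ B ⊔ C := by rw [hs]; trivial
      have hBn : B.Normal := ⟨fun b hb g => by
        rw [Subgroup.mem_center_iff.1 (hBZ hb), mul_inv_cancel_right]; exact hb⟩
      rw [Subgroup.mem_sup_of_normal_left] at this
      obtain ⟨b, hb, c, hc, e⟩ := this
      exact ⟨(⟨b, hb⟩, ⟨c, hc⟩), e⟩
  let e : (B × C) ≃* G := MulEquiv.ofBijective _ hbij
  have hb : ∀ b : B, e.symm b = (b, 1) := fun b => by
    rw [MulEquiv.symm_apply_eq]; exact (mul_one (b : G)).symm
  have hc : ∀ c : C, e.symm c = (1, c) := fun c => by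
    rw [MulEquiv.symm_apply_eq]; exact (one_mul (c : G)).symm
  refine ⟨(MonoidHom.fst B C).comp e.symm.toMonoidHom, (MonoidHom.snd B C).comp e.symm.toMonoidHom,
    ?_, ?_, ?_, ?_, ?_⟩
  · intro b; exact congrArg Prod.fst (hb b)
  · intro b; exact congrArg Prod.snd (hc b)
  · intro b; exact congrArg Prod.snd (hb b)
  · intro b; exact congrArg Prod.fst (hc b)
  · rw [← Nat.card_congr e.toEquiv, Nat.card_prod]

theorem main_aux [Finite G] (hG : IsPGroup p G)
    (B C : Subalgebra (ZMod p) (GA p G))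
    (hBcomm : ∀ b ∈ B, ∀ b' ∈ B, Commute b b')
    (hcomm : ∀ b ∈ B, ∀ c ∈ C, Commute b c)
    (hmul : Function.Bijective
      (Submodule.mulMap (Subalgebra.toSubmodule B) (Subalgebra.toSubmodule C))) :
    ∃ 𝓑 𝓒 : Subgroup G, 𝓑.Normal ∧ 𝓒.Normal ∧ Disjoint 𝓑 𝓒 ∧ 𝓑 ⊔ 𝓒 = ⊤ ∧
      Nonempty (B ≃ₐ[ZMod p] GA p 𝓑) ∧
      Nonempty (C ≃ₐ[ZMod p] GA p 𝓒) := by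
  obtain ⟨ρ, σ, hρB, hσC, hρa, hσa, hρρ, hid, hcen, hfr⟩ := rho_sigma p B C hcomm hmul
  have hcen : ∀ x y, Commute y (ρ x) := fun x =>
    hcen _ (hρB x) (fun b' hb' => hBcomm b' hb' _ (hρB x))
  have hker : ∀ g ∈ commutator G, ρ (emb p g) = 1 := by
    let f : G →* Bˣ := ((ρ.codRestrict B hρB : GA p G →* B).comp (emb p)).toHomUnits
    have hf : ∀ g, ((f g : B) : GA p G) = ρ (emb p g) := fun g => rfl
    have hle : commutator G ≤ f.ker := by
      rw [commutator_eq_closure, Subgroup.closure_le]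
      rintro _ ⟨a, b, rfl⟩
      have hab : Commute (f a) (f b) := by
        apply Units.ext
        apply Subtype.ext
        exact hBcomm _ (f a : B).2 _ (f b : B).2
      change f _ = 1
      rw [map_commutatorElement, commutatorElement_eq_one_iff_commute]
      exact hab
    intro g hg
    have := hle hg
    rw [MonoidHom.mem_ker] at this
    rw [← hf, this]; rfl
  let W : Subgroup G :=
    { carrier := {g | emb p g - ρ (emb p g) ∈ augI2 p G}
      one_mem' := by simp
      mul_mem' := by
        intro a b ha hb
        change emb p (a * b) - ρ (emb p (a * b)) ∈ augI2 p G
        have h1 := augI2_mul_mem p ha (emb p b)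
        have h2 := augI2_mul_mem p hb (ρ (emb p a))
        have := add_mem h1 h2
        convert this using 1
        rw [map_mul, map_mul, sub_mul, sub_mul, (hcen (emb p a) (emb p b)).eq,
          (hcen (emb p a) (ρ (emb p b))).eq]
        abel
      inv_mem' := by
        intro a ha
        change emb p a⁻¹ - ρ (emb p a⁻¹) ∈ augI2 p G
        have h1 := augI2_mul_mem p (neg_mem ha) (emb p a⁻¹ * ρ (emb p a⁻¹))
        convert h1 using 1
        have e1 : emb p a * emb p a⁻¹ = 1 := by rw [← map_mul]; simp
        have e2 : ρ (emb p a) * ρ (emb p a⁻¹) = 1 := by rw [← map_mul, e1, map_one]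
        rw [neg_sub, sub_mul, ← mul_assoc (emb p a), e1, one_mul, (hcen (emb p a⁻¹) (emb p a⁻¹)).eq,
          ← mul_assoc, e2, one_mul] }
  have hW : ∀ g, g ∈ W ↔ emb p g - ρ (emb p g) ∈ augI2 p G := fun g => Iff.rfl
  let K : Subgroup G := (dlHom p (G := G)).ker
  have hK : ∀ g, g ∈ K ↔ dl p g = 0 := fun g => Iff.rfl
  have hKI : ∀ g, dl p g = 0 ↔ emb p g - 1 ∈ augI2 p G := by
    intro g
    rw [← dl_one p (G := G), dl_eq_iff, map_one]
  have hKW : K ≤ W := by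
    intro g hg
    rw [hK, hKI] at hg
    rw [hW]
    have := sub_mem hg (map_augI2 p ρ hρa hg)
    simpa using this
  have hlift : ∀ g : G, ∀ j, g ^ p ^ j ∈ commutator G →
      ∃ z ∈ Subgroup.center G, z ^ p ^ j = 1 ∧ emb p z - ρ (emb p g) ∈ augI2 p G := by
    intro g j hj
    obtain ⟨z, hz, hzj, hd⟩ := lift_center p hG (b := ρ (emb p g) - 1)
      (fun h => (hcen _ _).sub_right (Commute.one_right _)) (by simp [hρa]) j (by
        rw [sub_one_pow, ← map_pow, ← map_pow, hker _ hj, sub_self])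
    refine ⟨z, hz, hzj, ?_⟩
    unfold dl at hd
    rw [← sub_eq_zero, ← map_sub, Submodule.mkQ_apply, Submodule.Quotient.mk_eq_zero] at hd
    simpa using hd
  obtain ⟨𝓑, 𝓒, hBZ, hdis, hsup, hBW, hWB⟩ := group_split p hG K W
    (fun y => (hK _).2 (dl_pow_p p y)) hKW (by
      intro g hg j hj
      obtain ⟨z, hz, hzj, hd⟩ := hlift g j hj
      refine ⟨z, hz, hzj, ?_⟩
      rw [hK, dl_mul, dl_inv, neg_add_eq_zero, dl_eq_iff]
      have := sub_mem hd hg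
      have := sub_mem hd ((hW g).1 hg)
      simpa using this)
  obtain ⟨πB, πC, hBB, hCC, hCB, hBC, hcard⟩ := exists_proj 𝓑 𝓒 hBZ hdis hsup
  have hBn : 𝓑.Normal := ⟨fun b hb g => by
    rw [Subgroup.mem_center_iff.1 (hBZ hb), mul_inv_cancel_right]; exact hb⟩
  have hCn : 𝓒.Normal := by
    have : 𝓒 = πB.ker := by
      ext g
      constructor
      · intro hg; exact hBC ⟨g, hg⟩
      · intro hg
        have hg' : g ∈ 𝓑 ⊔ 𝓒 := by rw [hsup]; trivial
        rw [Subgroup.mem_sup_of_normal_left] at hg'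
        obtain ⟨b, hb, c, hc, rfl⟩ := hg'
        rw [MonoidHom.mem_ker, map_mul, hBB ⟨b, hb⟩, hBC ⟨c, hc⟩, mul_one] at hg
        have : b = 1 := congrArg Subtype.val hg
        rw [this, one_mul]; exact hc
    rw [this]; infer_instance
  refine ⟨𝓑, 𝓒, hBn, hCn, hdis, hsup, ?_⟩
  let fB : B →ₐ[ZMod p] GA p 𝓑 := (gmap p πB).comp B.val
  let fC : C →ₐ[ZMod p] GA p 𝓒 := (gmap p πC).comp C.val
  have hfB : Function.Surjective fB := by
    rw [← AlgHom.range_eq_top]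
    apply subalg_top p (hG.to_subgroup 𝓑)
    intro h
    refine ⟨gmap p πB (ρ (emb p (h : G))), ⟨⟨_, hρB _⟩, rfl⟩, ?_⟩
    have := map_augI2 p (gmap p πB) (aug_gmap p πB) ((hW h).1 (hBW h.2))
    rwa [map_sub, gmap_emb, hBB] at this
  have hfC : Function.Surjective fC := by
    rw [← AlgHom.range_eq_top]
    apply subalg_top p (hG.to_subgroup 𝓒)
    intro c
    refine ⟨gmap p πC (σ (emb p (c : G))), ⟨⟨_, hσC _⟩, rfl⟩, ?_⟩
    obtain ⟨j, hj⟩ := hG (c : G)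
    obtain ⟨z, hz, -, hd⟩ := hlift c j (by rw [hj]; exact one_mem _)
    have hzW : z ∈ W := by
      rw [hW]
      have h1 := map_augI2 p ρ hρa hd
      rw [map_sub, hρρ] at h1
      have := sub_mem hd h1
      simpa using this
    obtain ⟨h, hh, hhz⟩ := hWB z hzW
    rw [hK, dl_mul, dl_inv, neg_add_eq_zero, dl_eq_iff] at hhz
    have h1 := add_mem (hid (emb p (c : G))) (neg_mem (add_mem hhz hd))
    have h2 := map_augI2 p (gmap p πC) (aug_gmap p πC) h1
    have h3 : gmap p πC (emb p h) = 1 := by rw [gmap_emb, hCB ⟨h, hh⟩, map_one]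
    have h4 : gmap p πC (emb p (c : G)) = emb p c := by rw [gmap_emb, hCC]
    convert h2 using 1
    rw [aug_emb, map_one]
    simp only [map_add, map_sub, map_neg, h3, h4, map_one]
    abel
  have hb1 : Nat.card 𝓑 ≤ Module.finrank (ZMod p) B := by
    rw [← finrank_ga p]
    exact LinearMap.finrank_le_finrank_of_surjective (f := fB.toLinearMap) hfB
  have hc1 : Nat.card 𝓒 ≤ Module.finrank (ZMod p) C := by
    rw [← finrank_ga p]
    exact LinearMap.finrank_le_finrank_of_surjective (f := fC.toLinearMap) hfC
  rw [finrank_ga, hcard] at hfr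
  have hb0 : 0 < Nat.card 𝓑 := Nat.card_pos
  have hc0 : 0 < Nat.card 𝓒 := Nat.card_pos
  have hb2 : Module.finrank (ZMod p) B = Nat.card 𝓑 := by
    apply le_antisymm _ hb1
    by_contra hlt
    nlinarith
  have hc2 : Module.finrank (ZMod p) C = Nat.card 𝓒 := by
    apply le_antisymm _ hc1
    by_contra hlt
    nlinarith
  constructor
  · refine ⟨AlgEquiv.ofBijective fB ⟨?_, hfB⟩⟩
    exact (LinearMap.injective_iff_surjective_of_finrank_eq_finrank (f := fB.toLinearMap)
      (by rw [hb2, finrank_ga])).2 hfB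
  · refine ⟨AlgEquiv.ofBijective fC ⟨?_, hfC⟩⟩
    exact (LinearMap.injective_iff_surjective_of_finrank_eq_finrank (f := fC.toLinearMap)
      (by rw [hc2, finrank_ga])).2 hfC

end Last

end

/-- Let `G` be a finite `p`-group and suppose `F_pG = B ⊗ C` for
subalgebras `B` and `C` with `B` commutative. Then there are subgroups `𝓑` and `𝓒` of `G`
with `G = 𝓑 × 𝓒` (internal direct product), `F_p𝓑 ≅ B` and `F_p𝓒 ≅ C`. -/
theorem stmt17 (p : ℕ) [Fact p.Prime]
    (G : Type*) [Group G] [Finite G] (hG : IsPGroup p G)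
    (B C : Subalgebra (ZMod p) (MonoidAlgebra (ZMod p) G))
    (hBcomm : ∀ b ∈ B, ∀ b' ∈ B, Commute b b')
    (hcomm : ∀ b ∈ B, ∀ c ∈ C, Commute b c)
    (hmul : Function.Bijective
      (Submodule.mulMap (Subalgebra.toSubmodule B) (Subalgebra.toSubmodule C))) :
    ∃ 𝓑 𝓒 : Subgroup G, 𝓑.Normal ∧ 𝓒.Normal ∧ Disjoint 𝓑 𝓒 ∧ 𝓑 ⊔ 𝓒 = ⊤ ∧
      Nonempty (B ≃ₐ[ZMod p] MonoidAlgebra (ZMod p) 𝓑) ∧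
      Nonempty (C ≃ₐ[ZMod p] MonoidAlgebra (ZMod p) 𝓒) := by
  exact main_aux p hG B C hBcomm hcomm hmul
end

section
/- Let G be a finite p-group that is indecomposable as a direct product of nontrivial subgroups and suppose G can be generated by 3 elements. Then F_pG admits no factorization F_pG = B ⊗ C with B and C proper subalgebras. -/
namespace Stmt18

lemma sum_eq_sum_center {p : ℕ} [Fact p.Prime] {G : Type*} [Group G] [Fintype G]
    (hG : IsPGroup p G) [DecidablePred (· ∈ Subgroup.center G)]
    {V : Type*} [AddCommGroup V] (hV : ∀ v : V, p • v = 0) (f : G → V)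
    (hf : ∀ g h, f (h * g * h⁻¹) = f g) :
    ∑ g, f g = ∑ g ∈ Finset.univ.filter (· ∈ Subgroup.center G), f g := by
  classical
  have key : ∀ v : V, (Finset.univ.filter (fun g => f g = v)).card • v =
      ((Finset.univ.filter (· ∈ Subgroup.center G)).filter (fun g => f g = v)).card • v := by
    intro v
    let X : SubMulAction (ConjAct G) G :=
      { carrier := {g | f g = v}
        smul_mem' := by
          intro c x hx
          simp only [Set.mem_ofPred_eq] at hx ⊢
          rw [ConjAct.smul_def, hf, hx] }
    have hG' : IsPGroup p (ConjAct G) := hG.of_equiv ConjAct.toConjAct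
    have h := hG'.card_modEq_card_fixedPoints X
    have h1 : Nat.card X = (Finset.univ.filter (fun g => f g = v)).card := by
      rw [← Fintype.card_subtype, ← Nat.card_eq_fintype_card]
      rfl
    have h2 : Nat.card (MulAction.fixedPoints (ConjAct G) X) =
        ((Finset.univ.filter (· ∈ Subgroup.center G)).filter (fun g => f g = v)).card := by
      rw [Finset.filter_filter, ← Fintype.card_subtype, ← Nat.card_eq_fintype_card]
      have hfix : ∀ y : X, y ∈ MulAction.fixedPoints (ConjAct G) X ↔
          (y : G) ∈ Subgroup.center G := by
        intro y
        rw [← SetLike.mem_coe, ← ConjAct.fixedPoints_eq_center]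
        simp only [MulAction.mem_fixedPoints, Subtype.ext_iff, SubMulAction.val_smul]
      exact Nat.card_congr
        { toFun := fun y => ⟨y.1.1, (hfix y.1).1 y.2, y.1.2⟩
          invFun := fun g => ⟨⟨g.1, g.2.2⟩, (hfix ⟨g.1, g.2.2⟩).2 g.2.1⟩
          left_inv := fun _ => rfl
          right_inv := fun _ => rfl }
    rw [h1, h2] at h
    have : ∀ m n : ℕ, m ≡ n [MOD p] → m • v = n • v := by
      intro m n hmn
      rw [← Nat.mod_add_div m p, ← Nat.mod_add_div n p, hmn, add_smul, add_smul, mul_comm p,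
        mul_comm p, mul_smul, mul_smul, hV, smul_zero, smul_zero]
    exact this _ _ h
  rw [← Finset.sum_fiberwise_of_maps_to (s := Finset.univ) (t := Finset.univ.image f) (g := f)
    (fun x hx => Finset.mem_image_of_mem f hx),
    ← Finset.sum_fiberwise_of_maps_to (s := Finset.univ.filter (· ∈ Subgroup.center G))
      (t := Finset.univ.image f) (g := f)
    (fun x hx => Finset.mem_image_of_mem f (Finset.mem_univ x))]
  refine Finset.sum_congr rfl fun v _ => ?_
  rw [Finset.sum_congr rfl (g := fun _ => v) (by intro x hx; exact (Finset.mem_filter.1 hx).2),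
    Finset.sum_congr (s₁ := Finset.filter _ (Finset.filter _ _)) rfl (g := fun _ => v)
      (by intro x hx; exact (Finset.mem_filter.1 hx).2),
    Finset.sum_const, Finset.sum_const, key]

open MonoidAlgebra

/-- restriction of coefficients to the center -/
noncomputable def res {p : ℕ} {G : Type*} [Group G] (a : MonoidAlgebra (ZMod p) G) :
    MonoidAlgebra (ZMod p) (Subgroup.center G) :=
  ofCoeff (a.coeff.comapDomain Subtype.val Subtype.val_injective.injOn)

lemma res_coeff {p : ℕ} {G : Type*} [Group G] (a : MonoidAlgebra (ZMod p) G)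
    (z : Subgroup.center G) : (res a).coeff z = a.coeff z := rfl

lemma coeff_conj {p : ℕ} {G : Type*} [Group G] {a : MonoidAlgebra (ZMod p) G}
    (ha : ∀ b, Commute a b) (g h : G) : a.coeff (h * g * h⁻¹) = a.coeff g := by
  have := congrArg (fun y => y.coeff (h * g)) (ha (single h 1)).eq
  simpa [coeff_mul_single_apply, coeff_single_mul_apply] using this

lemma sum_center_subtype {G : Type*} [Group G] [Fintype G]
    [DecidablePred (· ∈ Subgroup.center G)] {V : Type*} [AddCommGroup V] (f : G → V) :
    ∑ g ∈ Finset.univ.filter (· ∈ Subgroup.center G), f g = ∑ z : Subgroup.center G, f z :=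
  (Finset.sum_subtype _ (by simp) f)

lemma res_mul {p : ℕ} [Fact p.Prime] {G : Type*} [Group G] [Finite G]
    (hG : IsPGroup p G) {a b : MonoidAlgebra (ZMod p) G}
    (ha : ∀ c, Commute a c) (hb : ∀ c, Commute b c) : res (a * b) = res a * res b := by
  classical
  have := Fintype.ofFinite G
  ext w
  rw [res_coeff, coeff_mul_apply_left, coeff_mul_apply_left, Finsupp.sum_fintype _ _ (by simp),
    Finsupp.sum_fintype _ _ (by simp), sum_eq_sum_center hG (by simp), sum_center_subtype]
  · rfl
  · intro g h
    rw [coeff_conj ha]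
    congr 1
    have : (h * g * h⁻¹)⁻¹ * (w : G) = h * (g⁻¹ * w) * h⁻¹ := by
      have := Subgroup.mem_center_iff.1 w.2 h⁻¹
      simp only [mul_inv_rev, inv_inv, mul_assoc, this]
    rw [this, coeff_conj hb]

lemma res_one {p : ℕ} {G : Type*} [Group G] :
    res (1 : MonoidAlgebra (ZMod p) G) = 1 := by
  classical
  ext w
  rw [res_coeff, one_def, one_def]
  simp [coeff_single, Finsupp.single_apply, eq_comm]

lemma res_pow {p : ℕ} [Fact p.Prime] {G : Type*} [Group G] [Finite G]
    (hG : IsPGroup p G) {a : MonoidAlgebra (ZMod p) G}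
    (ha : ∀ c, Commute a c) (n : ℕ) : res (a ^ n) = res a ^ n := by
  induction n with
  | zero => simp [res_one]
  | succ n ih => rw [pow_succ, pow_succ, res_mul hG (fun c => (ha c).pow_left n) ha, ih]

instance {p : ℕ} [Fact p.Prime] {G : Type*} [Group G] : CharP (MonoidAlgebra (ZMod p) G) p :=
  charP_of_injective_algebraMap (algebraMap (ZMod p) (MonoidAlgebra (ZMod p) G)).injective p

lemma sum_pow_of_commute {p : ℕ} [Fact p.Prime] {A : Type*} [Ring A] [CharP A p] {ι : Type*}
    (s : Finset ι) (f : ι → A) (hf : ∀ i j, Commute (f i) (f j)) (k : ℕ) :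
    (∑ i ∈ s, f i) ^ p ^ k = ∑ i ∈ s, f i ^ p ^ k := by
  classical
  induction s using Finset.induction_on with
  | empty => simp [(Fact.out : p.Prime).ne_zero]
  | insert a s ha ih =>
    rw [Finset.sum_insert ha, Finset.sum_insert ha, add_pow_char_pow_of_commute, ih]
    exact Commute.sum_right _ _ _ fun i _ => hf a i

lemma exists_central {p : ℕ} [Fact p.Prime] {G : Type*} [Group G] [Finite G]
    (hG : IsPGroup p G) {x : MonoidAlgebra (ZMod p) G}
    (hx : ∀ c, Commute x c) {k : ℕ} (hk : x ^ p ^ k = 0) {R : Type*} [CommRing R]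
    (φ : MonoidAlgebra (ZMod p) G →+* R) (I : Ideal R) (hI : φ x ∉ I) :
    ∃ z ∈ Subgroup.center G, z ^ p ^ k = 1 ∧ φ (of (ZMod p) G z) - 1 ∉ I := by
  classical
  have := Fintype.ofFinite G
  by_contra! hcon
  apply hI
  let ψ : R →+* R ⧸ I := Ideal.Quotient.mk I
  rw [← Ideal.Quotient.eq_zero_iff_mem]
  let _ : Algebra (ZMod p) (R ⧸ I) :=
    ((ψ.comp φ).comp (algebraMap (ZMod p) (MonoidAlgebra (ZMod p) G))).toAlgebra
  have hchar : ∀ v : R ⧸ I, p • v = 0 := by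
    intro v
    rw [← Nat.cast_smul_eq_nsmul (ZMod p)]; simp
  have hsm : ∀ (c : ZMod p) (g : G), ψ (φ (single g c)) = c • ψ (φ (of (ZMod p) G g)) := by
    intro c g
    rw [Algebra.smul_def]
    change _ = ψ (φ (algebraMap (ZMod p) (MonoidAlgebra (ZMod p) G) c)) * _
    rw [← map_mul, ← map_mul]
    simp
  have h1 : ψ (φ x) = ∑ z : Subgroup.center G, x.coeff z • ψ (φ (of (ZMod p) G z)) := by
    have h0 : ψ (φ x) = ∑ g : G, x.coeff g • ψ (φ (of (ZMod p) G g)) := by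
      conv_lhs => rw [← sum_coeff_single x, Finsupp.sum_fintype _ _ (by simp), map_sum, map_sum]
      exact Finset.sum_congr rfl fun g _ => hsm _ _
    rw [h0, sum_eq_sum_center hG hchar, sum_center_subtype]
    intro g h
    rw [coeff_conj hx]
    congr 1
    have h1 : ψ (φ (of (ZMod p) G h)) * ψ (φ (of (ZMod p) G h⁻¹)) = 1 := by
      rw [← map_mul, ← map_mul, ← map_mul, mul_inv_cancel, map_one, map_one, map_one]
    rw [map_mul, map_mul, map_mul, map_mul, map_mul, map_mul, mul_right_comm, h1, one_mul]
  let F : Subgroup.center G → R ⧸ I := fun z => ψ (φ (of (ZMod p) G z))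
  have hF : F.FactorsThrough (fun z : Subgroup.center G => z ^ p ^ k) := by
    intro z w hzw
    have h2 : ψ (φ (of (ZMod p) G (z * w⁻¹ : Subgroup.center G))) = 1 := by
      have := hcon (z * w⁻¹ : Subgroup.center G) (SetLike.coe_mem _) (by
        have : (z * w⁻¹) ^ p ^ k = 1 := by
          simp only at hzw
          have hc : Commute z w⁻¹ := Subtype.ext (Subgroup.mem_center_iff.1 (w⁻¹).2 z)
          rw [hc.mul_pow, inv_pow, hzw, mul_inv_cancel]
        exact congrArg Subtype.val this)
      rw [← Ideal.Quotient.eq_zero_iff_mem, map_sub, map_one, sub_eq_zero] at this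
      exact this
    have h3 : z = (z * w⁻¹) * w := by group
    change ψ (φ (of (ZMod p) G z)) = ψ (φ (of (ZMod p) G w))
    rw [h3, Subgroup.coe_mul, map_mul, map_mul, map_mul, h2, one_mul]
  let E : Subgroup.center G → R ⧸ I := Function.extend (fun z => z ^ p ^ k) F 0
  have hE : ∀ z, E (z ^ p ^ k) = F z := fun z => hF.extend_apply 0 z
  have h4 : res x ^ p ^ k = 0 := by
    rw [← res_pow hG hx, hk]; ext; simp [res_coeff]
  have h5 : ∑ z : Subgroup.center G, single (z ^ p ^ k) (x.coeff z) = 0 := by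
    rw [← h4]
    conv_rhs => rw [← sum_coeff_single (res x), Finsupp.sum_fintype _ _ (by simp)]
    rw [sum_pow_of_commute]
    swap
    · intro z w
      exact single_commute_single (Subtype.ext (Subgroup.mem_center_iff.1 w.2 z)) (Commute.all _ _)
    refine Finset.sum_congr rfl fun z _ => ?_
    rw [single_pow, ZMod.pow_card_pow]; rfl
  let L : MonoidAlgebra (ZMod p) (Subgroup.center G) →+ R ⧸ I :=
    (Finsupp.liftAddHom (fun z => ((AddMonoidHom.flip (smulAddHom (ZMod p) (R ⧸ I))) (E z)))).comp
      (coeffAddEquiv (R := ZMod p) (M := Subgroup.center G)).toAddMonoidHom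
  have hL : ∀ z c, L (single z c) = c • E z := by
    intro z c
    simp [L, coeffAddEquiv]
  have h6 := congrArg L h5
  rw [map_sum, map_zero] at h6
  change ψ (φ x) = 0
  rw [h1, ← h6]
  refine Finset.sum_congr rfl fun z _ => ?_
  rw [hL, hE]

end Stmt18
namespace Stmt18
open MonoidAlgebra

/-- the augmentation map -/
noncomputable abbrev aug (p : ℕ) (G : Type*) [Group G] :
    MonoidAlgebra (ZMod p) G →ₐ[ZMod p] ZMod p := MonoidAlgebra.lift (ZMod p) (ZMod p) G 1

lemma finite_alg (p : ℕ) [Fact p.Prime] (G : Type*) [Group G] [Finite G] :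
    Finite (MonoidAlgebra (ZMod p) G) :=
  have := Fintype.ofFinite G
  Finite.of_injective (fun a : MonoidAlgebra (ZMod p) G => (fun g => a.coeff g))
    (fun a b h => by ext g; exact congrFun h g)

lemma core {p : ℕ} [Fact p.Prime] {G : Type*} [Group G] [Finite G] (hG : IsPGroup p G)
    (hindec : ∀ H K : Subgroup G, H.Normal → K.Normal →
      Disjoint H K → H ⊔ K = ⊤ → H = ⊥ ∨ K = ⊥)
    {x : MonoidAlgebra (ZMod p) G} (hx : ∀ c, Commute x c) (hnil : IsNilpotent x)
    {R : Type*} [CommRing R] (φ : MonoidAlgebra (ZMod p) G →+* R)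
    (hsurj : Function.Surjective φ) (ht : φ x ≠ 0)
    (hinj : ∀ n, φ x ^ n = 0 → x ^ n = 0)
    (hker : ∀ a, aug p G a = 0 → ∃ r, φ a = φ x * r) :
    ∃ z : G, Subgroup.zpowers z = ⊤ := by
  classical
  have hp : p.Prime := Fact.out
  have := finite_alg p G
  have : Finite R := Finite.of_surjective _ hsurj
  set t := φ x with htdef
  have htnil : IsNilpotent t := hnil.map φ
  have hex : ∃ k, x ^ p ^ k = 0 := by
    obtain ⟨n, hn⟩ := hnil
    exact ⟨n, pow_eq_zero_of_le (Nat.lt_pow_self hp.one_lt).le hn⟩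
  obtain ⟨k, hk, hk'⟩ : ∃ k, x ^ p ^ (k + 1) = 0 ∧ x ^ p ^ k ≠ 0 := by
    have h0 : Nat.find hex ≠ 0 := by
      intro h
      have := Nat.find_spec hex
      rw [h, pow_zero, pow_one] at this
      exact ht (by rw [htdef, this, map_zero])
    obtain ⟨k, hk⟩ := Nat.exists_eq_succ_of_ne_zero h0
    refine ⟨k, ?_, Nat.find_min hex (by omega)⟩
    have := Nat.find_spec hex
    rwa [hk] at this
  have htk : t ^ p ^ k ≠ 0 := fun h => hk' (hinj _ h)
  have htk1 : t ^ p ^ (k + 1) = 0 := by rw [htdef, ← map_pow, hk, map_zero]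
  have hI : φ x ∉ Ideal.span {t ^ 2} := by
    intro h
    obtain ⟨r, hr⟩ := Ideal.mem_span_singleton'.1 h
    have h1 : IsUnit (1 - r * t) := ((Commute.all r t).isNilpotent_mul_left htnil).isUnit_one_sub
    have h2 : t * (1 - r * t) = 0 := by
      rw [← htdef] at hr
      linear_combination -hr
    exact ht (h1.mul_left_eq_zero.1 h2)
  obtain ⟨z, hzc, hzk, hz⟩ := exists_central hG hx hk φ _ hI
  have haug : ∀ g : G, aug p G (of (ZMod p) G g - 1) = 0 := by
    intro g; simp
  obtain ⟨r, hr⟩ := hker _ (haug z)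
  rw [map_sub, map_one] at hr
  have hru : IsUnit r := by
    obtain ⟨a, rfl⟩ := hsurj r
    have ha : aug p G a ≠ 0 := by
      intro h
      obtain ⟨s, hs⟩ := hker a h
      apply hz
      rw [hr, hs]
      exact Ideal.mem_span_singleton'.2 ⟨s, by ring⟩
    obtain ⟨s, hs⟩ := hker (a - algebraMap _ _ (aug p G a)) (by
      rw [map_sub, AlgHom.commutes]; simp)
    rw [map_sub, sub_eq_iff_eq_add'] at hs
    rw [hs]
    have h1 : IsUnit (φ (algebraMap (ZMod p) (MonoidAlgebra (ZMod p) G) (aug p G a))) :=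
      ((IsUnit.mk0 _ ha).map (algebraMap (ZMod p) (MonoidAlgebra (ZMod p) G))).map φ
    exact ((Commute.all t s).isNilpotent_mul_right htnil).isUnit_add_left_of_commute h1 (Commute.all _ _)
  have hpow : ∀ (g : G) (n : ℕ), φ (of (ZMod p) G g) ^ p ^ n - 1 =
      (φ (of (ZMod p) G g) - 1) ^ p ^ n := by
    intro g n
    have e := congrArg φ (sub_pow_char_pow_of_commute p n
      (Commute.one_right (of (ZMod p) G g)))
    rw [one_pow, map_sub, map_pow, map_sub, map_pow, map_one] at e
    exact e.symm
  let U : G →* Rˣ := (φ.toMonoidHom.comp (of (ZMod p) G)).toHomUnits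
  have hU : ∀ g, ((U g : Rˣ) : R) = φ (of (ZMod p) G g) := fun g => rfl
  have hUz : U z ^ p ^ k ≠ 1 := by
    intro h
    have h1 : φ (of (ZMod p) G z) ^ p ^ k = 1 := by
      rw [← hU, ← Units.val_pow_eq_pow_val, h, Units.val_one]
    have h2 := hpow z k
    rw [h1, hr, sub_self, mul_pow] at h2
    exact htk ((hru.pow _).mul_left_eq_zero.1 h2.symm)
  have hUg : ∀ g, U g ^ p ^ (k + 1) = 1 := by
    intro g
    ext
    rw [Units.val_pow_eq_pow_val, hU, Units.val_one, ← sub_eq_zero, hpow]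
    obtain ⟨s, hs⟩ := hker _ (haug g)
    rw [map_sub, map_one] at hs
    rw [hs, mul_pow, htk1, zero_mul]
  have : NeZero (Monoid.exponent Rˣ) := ⟨Monoid.exponent_ne_zero_of_finite⟩
  obtain ⟨χ, hχ⟩ := CommGroup.exists_apply_ne_one_of_hasEnoughRootsOfUnity Rˣ ℂ hUz
  let c : G →* ℂˣ := χ.comp U
  have hcg : ∀ g, c g ^ p ^ (k + 1) = 1 := by
    intro g
    change χ (U g) ^ _ = 1
    rw [← map_pow, hUg, map_one]
  have hcz : orderOf (c z) = p ^ (k + 1) := by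
    apply orderOf_eq_prime_pow _ (hcg z)
    change ¬ χ (U z) ^ _ = 1
    rwa [← map_pow]
  have hprim : IsPrimitiveRoot (c z) (p ^ (k + 1)) := hcz ▸ IsPrimitiveRoot.orderOf (c z)
  have hN : (Subgroup.zpowers z).Normal := by
    refine ⟨fun n hn g => ?_⟩
    have : n ∈ Subgroup.center G := (Subgroup.zpowers_le.2 hzc) hn
    rw [Subgroup.mem_center_iff.1 this g, mul_inv_cancel_right]
    exact hn
  have hdis : Disjoint (Subgroup.zpowers z) c.ker := by
    rw [Subgroup.disjoint_def]
    rintro g ⟨n, rfl⟩ hg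
    simp only at hg ⊢
    rw [MonoidHom.mem_ker, map_zpow, ← orderOf_dvd_iff_zpow_eq_one, hcz] at hg
    exact orderOf_dvd_iff_zpow_eq_one.1
      ((Int.natCast_dvd_natCast.2 (orderOf_dvd_of_pow_eq_one hzk)).trans hg)
  have hsup : Subgroup.zpowers z ⊔ c.ker = ⊤ := by
    rw [eq_top_iff]
    intro g _
    have : NeZero (p ^ (k+1)) := ⟨(pow_pos hp.pos _).ne'⟩
    obtain ⟨i, -, hi⟩ := (IsPrimitiveRoot.coe_units_iff.2 hprim).eq_pow_of_pow_eq_one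
      (ξ := (c g : ℂ)) (by rw [← Units.val_pow_eq_pow_val, hcg, Units.val_one])
    have hi' : c z ^ i = c g := by ext; simpa using hi
    have : g = z ^ i * ((z ^ i)⁻¹ * g) := by group
    rw [this]
    refine Subgroup.mul_mem_sup (Subgroup.npow_mem_zpowers _ _) ?_
    rw [MonoidHom.mem_ker, map_mul, map_inv, map_pow, hi', inv_mul_cancel]
  rcases hindec (Subgroup.zpowers z) c.ker hN inferInstance hdis hsup with h | h
  · exfalso
    rw [Subgroup.zpowers_eq_bot] at h
    apply hUz
    rw [h, map_one, one_pow]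
  · exact ⟨z, by rwa [h, sup_bot_eq] at hsup⟩

lemma aug_ideal_nilpotent {p : ℕ} [Fact p.Prime] {G : Type*} [Group G] [Finite G]
    (hG : IsPGroup p G) : ∃ n, (LinearMap.ker (aug p G).toLinearMap) ^ n = ⊥ := by
  have hp : p.Prime := Fact.out
  have := finite_alg p G
  set I := LinearMap.ker (aug p G).toLinearMap with hIdef
  have hIA : ∀ a : MonoidAlgebra (ZMod p) G, ∀ b ∈ I, a * b ∈ I := by
    intro a b hb
    simp only [hIdef, LinearMap.mem_ker, AlgHom.toLinearMap_apply, map_mul] at hb ⊢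
    rw [hb, mul_zero]
  have hII : I * I ≤ I := Submodule.mul_le.2 fun a _ b hb => hIA a b hb
  have hanti : Antitone (fun n => I ^ (n + 1)) := by
    apply antitone_nat_of_succ_le
    intro n
    rw [pow_succ, pow_succ, mul_assoc]
    exact mul_le_mul' le_rfl hII
  obtain ⟨m, hm⟩ : ∃ m, I ^ (m + 1) = I * I ^ (m + 1) := by
    have hfin : Finite (Submodule (ZMod p) (MonoidAlgebra (ZMod p) G)) :=
      Finite.of_injective _ SetLike.coe_injective
    obtain ⟨m, n, hmn, h⟩ := Finite.exists_ne_map_eq_of_infinite (fun n => I ^ (n + 1))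
    wlog hlt : m < n generalizing m n
    · exact this n m hmn.symm h.symm (by omega)
    refine ⟨m, ?_⟩
    rw [← pow_succ']
    refine le_antisymm ?_ (hanti (Nat.le_succ m))
    rw [h]
    exact hanti (show m + 1 ≤ n from hlt)
  refine ⟨m + 1, ?_⟩
  set W := I ^ (m + 1) with hW
  have hWA : ∀ a : MonoidAlgebra (ZMod p) G, ∀ w ∈ W, a * w ∈ W := by
    intro a w hw
    rw [hm] at hw
    refine Submodule.mul_induction_on hw ?_ ?_
    · intro b hb c hc
      rw [← mul_assoc, hm]
      exact Submodule.mul_mem_mul (hIA a b hb) hc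
    · intro b c hb hc
      rw [mul_add]
      exact W.add_mem hb hc
  by_contra hne
  have : Nontrivial W := Submodule.nontrivial_iff_ne_bot.2 hne
  let ρ : Representation (ZMod p) G W :=
    { toFun := fun g => (LinearMap.mulLeft (ZMod p) (of (ZMod p) G g)).restrict (hWA _)
      map_one' := by ext w; simp [LinearMap.restrict_apply]
      map_mul' := by
        intro g h
        refine LinearMap.ext fun w => Subtype.ext ?_
        change of (ZMod p) G (g * h) * (w : MonoidAlgebra (ZMod p) G) =
          of (ZMod p) G g * (of (ZMod p) G h * w)
        rw [map_mul, mul_assoc] }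
  have hρ : ∀ g w, ((ρ g w : W) : MonoidAlgebra (ZMod p) G) = of (ZMod p) G g * w :=
    fun _ _ => rfl
  let _ : MulAction G (Module.Dual (ZMod p) W) := MulAction.compHom _ ρ.dual
  have hsm : ∀ (g : G) (f : Module.Dual (ZMod p) W) w, (g • f) w = f (ρ g⁻¹ w) :=
    fun _ _ _ => rfl
  have hcard : p ∣ Nat.card (Module.Dual (ZMod p) W) := by
    rw [Module.natCard_eq_pow_finrank (K := ZMod p), Nat.card_zmod]
    exact dvd_pow_self _ (Module.finrank_pos (R := ZMod p)).ne'
  have hfinD : Finite (Module.Dual (ZMod p) W) := Module.finite_of_finite (ZMod p)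
  obtain ⟨f, hf, hf0⟩ := hG.exists_fixed_point_of_prime_dvd_card_of_fixed_point
    (Module.Dual (ZMod p) W) hcard (a := 0) (by intro g; ext w; simp [hsm])
  apply hf0
  have hfg : ∀ g w, f (ρ g w) = f w := by
    intro g w
    have := congrArg (fun F => F w) (hf g⁻¹)
    simpa [hsm] using this
  have hfa : ∀ (w : W) (a : MonoidAlgebra (ZMod p) G),
      f ⟨a * w, hWA a w w.2⟩ = aug p G a * f w := by
    intro w a
    let F : MonoidAlgebra (ZMod p) G →ₗ[ZMod p] ZMod p :=
      f ∘ₗ ((LinearMap.mulRight (ZMod p) (w : MonoidAlgebra (ZMod p) G)).codRestrict W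
        (fun a => hWA a w w.2))
    have hF : F = (LinearMap.mulRight (ZMod p) (f w)) ∘ₗ (aug p G).toLinearMap := by
      refine MonoidAlgebra.lhom_ext' fun g => LinearMap.ext_ring ?_
      have : F (of (ZMod p) G g) = f w := hfg g w
      simpa using this
    exact congrArg (fun H => H a) hF
  ext ⟨w, hw⟩
  have key : ∀ v ∈ W, ∃ hv : v ∈ W, f ⟨v, hv⟩ = 0 := by
    intro v hv
    rw [hm] at hv
    refine Submodule.mul_induction_on hv ?_ ?_
    · intro b hb c hc
      refine ⟨hWA b c hc, ?_⟩
      rw [hfa ⟨c, hc⟩ b]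
      have : aug p G b = 0 := hb
      rw [this, zero_mul]
    · rintro b c ⟨hb, hb'⟩ ⟨hc, hc'⟩
      refine ⟨W.add_mem hb hc, ?_⟩
      have : (⟨b + c, W.add_mem hb hc⟩ : W) = ⟨b, hb⟩ + ⟨c, hc⟩ := rfl
      rw [this, map_add, hb', hc', add_zero]
  obtain ⟨_, h⟩ := key w hw
  simp [h]

end Stmt18
namespace Stmt18
open MonoidAlgebra
open scoped TensorProduct

/-- the augmentation ideal, as a submodule -/
noncomputable abbrev augI (p : ℕ) (G : Type*) [Group G] :
    Submodule (ZMod p) (MonoidAlgebra (ZMod p) G) := LinearMap.ker (aug p G).toLinearMap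

/-- the augmentation ideal of a subalgebra -/
noncomputable abbrev JJ {p : ℕ} {G : Type*} [Group G]
    (C : Subalgebra (ZMod p) (MonoidAlgebra (ZMod p) G)) :
    Submodule (ZMod p) (MonoidAlgebra (ZMod p) G) := Subalgebra.toSubmodule C ⊓ augI p G

/-- the tensor factorization data -/
def Fact' {p : ℕ} {G : Type*} [Group G]
    (B C : Subalgebra (ZMod p) (MonoidAlgebra (ZMod p) G)) : Prop :=
  (∀ b ∈ B, ∀ c ∈ C, Commute b c) ∧ Function.Bijective
        (Submodule.mulMap (Subalgebra.toSubmodule B) (Subalgebra.toSubmodule C))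

variable {p : ℕ} [Fact p.Prime] {G : Type*} [Group G]
  {B C : Subalgebra (ZMod p) (MonoidAlgebra (ZMod p) G)}

lemma mem_JJ {a : MonoidAlgebra (ZMod p) G} : a ∈ JJ C ↔ a ∈ C ∧ aug p G a = 0 := Iff.rfl

lemma Fact'.symm (h : Fact' B C) : Fact' C B := by
  refine ⟨fun c hc b hb => (h.1 b hb c hc).symm, ?_⟩
  rw [Submodule.mulMap_comm_of_commute _ _ (fun m n => h.1 m.1 m.2 n.1 n.2)]
  exact h.2.comp (TensorProduct.comm _ _ _).bijective

lemma Fact'.top (h : Fact' B C) :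
    Subalgebra.toSubmodule B * Subalgebra.toSubmodule C = ⊤ := by
  rw [← Submodule.mulMap_range, LinearMap.range_eq_top]
  exact h.2.2

lemma abs_proj {K A : Type*} [CommRing K] [Ring A] [Algebra K A] (B C : Subalgebra K A)
    (ε : A →ₐ[K] K) (hc : ∀ b ∈ B, ∀ c ∈ C, Commute b c)
    (hb : Function.Bijective
      (Submodule.mulMap (Subalgebra.toSubmodule B) (Subalgebra.toSubmodule C))) :
    ∃ φ : A →ₐ[K] C, (∀ b ∈ B, φ b = algebraMap K C (ε b)) ∧ (∀ c : C, φ c = c) := by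
  let e : B ⊗[K] C →ₐ[K] A :=
    Algebra.TensorProduct.lift B.val C.val (fun b c => hc b b.2 c c.2)
  have het : ∀ (b : B) (c : C), e (b ⊗ₜ[K] c) = (b : A) * (c : A) := fun b c =>
    Algebra.TensorProduct.lift_tmul _ _ _ _ _
  have he : Function.Bijective e := by
    have : (e.toLinearMap : B ⊗[K] C →ₗ[K] A) =
        Submodule.mulMap (Subalgebra.toSubmodule B) (Subalgebra.toSubmodule C) :=
      TensorProduct.ext' fun _ _ => rfl
    rw [← this] at hb
    exact hb
  clear_value e
  let ψ : B ⊗[K] C →ₐ[K] C :=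
    Algebra.TensorProduct.lift ((Algebra.ofId K C).comp (ε.comp B.val))
      (AlgHom.id K C) (fun b c => Algebra.commute_algebraMap_left (ε b) c)
  have hψt : ∀ (b : B) (c : C), ψ (b ⊗ₜ[K] c) = algebraMap K C (ε b) * c := fun b c =>
    Algebra.TensorProduct.lift_tmul _ _ _ _ _
  clear_value ψ
  have hE : ∀ t, (AlgEquiv.ofBijective e he).symm (e t) = t := fun t =>
    (AlgEquiv.ofBijective e he).symm_apply_apply t
  refine ⟨ψ.comp ((AlgEquiv.ofBijective e he).symm : A →ₐ[K] B ⊗[K] C), ?_, ?_⟩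
  · intro b hb
    have h1 := het ⟨b, hb⟩ 1
    rw [OneMemClass.coe_one, mul_one] at h1
    have h2 := hE ((⟨b, hb⟩ : B) ⊗ₜ[K] (1 : C))
    rw [h1] at h2
    have h3 := hψt ⟨b, hb⟩ 1
    rw [mul_one] at h3
    exact (congrArg ψ h2).trans h3
  · intro c
    have h1 := het 1 c
    rw [OneMemClass.coe_one, one_mul] at h1
    have h2 := hE ((1 : B) ⊗ₜ[K] c)
    rw [h1] at h2
    have h3 := hψt 1 c
    rw [OneMemClass.coe_one, map_one, map_one, one_mul] at h3
    exact (congrArg ψ h2).trans h3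

lemma Fact'.proj (h : Fact' B C) : ∃ φ : MonoidAlgebra (ZMod p) G →ₐ[ZMod p] C,
    (∀ b ∈ B, φ b = algebraMap (ZMod p) C (aug p G b)) ∧ (∀ c : C, φ c = c) :=
  abs_proj B C (aug p G) h.1 h.2

lemma Fact'.aug_proj (h : Fact' B C) {φ : MonoidAlgebra (ZMod p) G →ₐ[ZMod p] C}
    (hB : ∀ b ∈ B, φ b = algebraMap (ZMod p) C (aug p G b)) (hC : ∀ c : C, φ c = c)
    (a : MonoidAlgebra (ZMod p) G) : aug p G (φ a : MonoidAlgebra (ZMod p) G) = aug p G a := by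
  have ha : a ∈ Subalgebra.toSubmodule B * Subalgebra.toSubmodule C := by rw [h.top]; trivial
  refine Submodule.mul_induction_on ha ?_ ?_
  · intro b hb c hc
    rw [map_mul, hB b hb, hC ⟨c, hc⟩, Subalgebra.coe_mul, map_mul, map_mul]
    congr 1
    exact (aug p G).commutes _
  · intro b c hb hc
    rw [map_add, Subalgebra.coe_add, map_add, map_add, hb, hc]

lemma JJ_mul_le : JJ C * JJ C ≤ JJ C := by
  refine Submodule.mul_le.2 fun a ha b hb => ?_
  rw [mem_JJ] at *
  exact ⟨C.mul_mem ha.1 hb.1, by rw [map_mul, ha.2, zero_mul]⟩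

lemma JJ_ne_bot (hC : C ≠ ⊥) : JJ C ≠ ⊥ := by
  intro h
  apply hC
  rw [eq_bot_iff]
  intro c hc
  have : c - algebraMap _ _ (aug p G c) ∈ JJ C :=
    mem_JJ.2 ⟨C.sub_mem hc (C.algebraMap_mem _), by rw [map_sub, AlgHom.commutes]; simp⟩
  rw [h, Submodule.mem_bot, sub_eq_zero] at this
  rw [this]
  exact Subalgebra.algebraMap_mem _ _

lemma pow_mono' {I J : Submodule (ZMod p) (MonoidAlgebra (ZMod p) G)} (h : I ≤ J) (n : ℕ) :
    I ^ n ≤ J ^ n := by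
  induction n with
  | zero => simp
  | succ n ih => rw [pow_succ, pow_succ]; exact mul_le_mul' ih h

lemma JJ_nil [Finite G] (hG : IsPGroup p G)
    (C : Subalgebra (ZMod p) (MonoidAlgebra (ZMod p) G)) : ∃ n, JJ C ^ (n + 1) = ⊥ := by
  obtain ⟨n, hn⟩ := aug_ideal_nilpotent (p := p) hG
  refine ⟨n, ?_⟩
  rw [eq_bot_iff]
  calc JJ C ^ (n + 1) ≤ augI p G ^ (n + 1) := pow_mono' inf_le_right _
    _ = ⊥ := by rw [pow_succ, hn, Submodule.bot_mul]
    _ ≤ ⊥ := le_rfl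

lemma JJ_not_le [Finite G] (hG : IsPGroup p G) (hC : C ≠ ⊥) : ¬ JJ C ≤ JJ C * JJ C := by
  intro h
  obtain ⟨n, hn⟩ := JJ_nil hG C
  apply JJ_ne_bot hC
  rw [eq_bot_iff, ← hn]
  clear hn
  induction n with
  | zero => simp
  | succ n ih =>
    rw [pow_succ]
    exact h.trans (mul_le_mul' ih le_rfl)

lemma le_adjoin {J : Submodule (ZMod p) (MonoidAlgebra (ZMod p) G)} (hJ : J * J ≤ J)
    {N : ℕ} (hN : J ^ (N + 1) = ⊥) {x : MonoidAlgebra (ZMod p) G} (hx : x ∈ J)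
    (h : J ≤ Submodule.span (ZMod p) {x} ⊔ J * J) :
    J ≤ Subalgebra.toSubmodule (Algebra.adjoin (ZMod p) {x}) := by
  set M := Subalgebra.toSubmodule (Algebra.adjoin (ZMod p) {x}) ⊓ J with hM
  have key : ∀ n, J ≤ M ⊔ J ^ (n + 1) := by
    intro n
    induction n with
    | zero => simp
    | succ n ih =>
      refine h.trans (sup_le ?_ ?_)
      · refine le_trans ?_ le_sup_left
        rw [Submodule.span_singleton_le_iff_mem]
        exact ⟨Algebra.self_mem_adjoin_singleton _ _, hx⟩
      · refine Submodule.mul_le.2 fun a ha b hb => ?_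
        obtain ⟨m1, hm1, j1, hj1, rfl⟩ := Submodule.mem_sup.1 (ih ha)
        obtain ⟨m2, hm2, j2, hj2, rfl⟩ := Submodule.mem_sup.1 (ih hb)
        have e : (m1 + j1) * (m2 + j2) = m1 * m2 + (m1 * j2 + j1 * (m2 + j2)) := by noncomm_ring
        rw [e]
        refine Submodule.add_mem_sup ⟨?_, hJ (Submodule.mul_mem_mul hm1.2 hm2.2)⟩
          (Submodule.add_mem _ ?_ ?_)
        · exact Subalgebra.mul_mem _ hm1.1 hm2.1
        · rw [pow_succ']; exact Submodule.mul_mem_mul hm1.2 hj2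
        · rw [pow_succ]; exact Submodule.mul_mem_mul hj1 hb
  have := key N
  rw [hN, sup_bot_eq] at this
  exact this.trans inf_le_left

lemma half [Finite G] (hG : IsPGroup p G)
    (hindec : ∀ H K : Subgroup G, H.Normal → K.Normal →
      Disjoint H K → H ⊔ K = ⊤ → H = ⊥ ∨ K = ⊥)
    (h : Fact' B C) (hC : C ≠ ⊥) {x : MonoidAlgebra (ZMod p) G} (hx : x ∈ JJ C)
    (hJ : JJ C ≤ Submodule.span (ZMod p) {x} ⊔ JJ C * JJ C) :
    ∃ z : G, Subgroup.zpowers z = ⊤ := by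
  obtain ⟨N, hN⟩ := JJ_nil hG C
  have hadj := le_adjoin JJ_mul_le hN hx hJ
  have hpoly : ∀ c ∈ C, ∃ q : Polynomial (ZMod p), Polynomial.aeval x q = c := by
    intro c hc
    have h1 : c - algebraMap _ _ (aug p G c) ∈ JJ C :=
      mem_JJ.2 ⟨C.sub_mem hc (C.algebraMap_mem _), by rw [map_sub, AlgHom.commutes]; simp⟩
    have h2 := hadj h1
    have h3 : c ∈ Algebra.adjoin (ZMod p) {x} := by
      have := (Algebra.adjoin (ZMod p) {x}).add_mem h2
        ((Algebra.adjoin (ZMod p) {x}).algebraMap_mem (aug p G c))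
      rwa [sub_add_cancel] at this
    rw [Algebra.adjoin_singleton_eq_range_aeval] at h3
    exact h3
  have hcomm : ∀ c ∈ C, ∀ d ∈ C, c * d = d * c := by
    intro c hc d hd
    obtain ⟨q, rfl⟩ := hpoly c hc
    obtain ⟨r, rfl⟩ := hpoly d hd
    rw [← map_mul, ← map_mul, mul_comm]
  obtain ⟨φ, hφB, hφC⟩ := h.proj
  let inst : CommRing C :=
    { (inferInstance : Ring C) with
      mul_comm := fun c d => Subtype.ext (hcomm c c.2 d d.2) }
  have hx0 : x ≠ 0 := by
    rintro rfl
    apply JJ_not_le hG hC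
    simpa using hJ
  have hφx : φ x = ⟨x, hx.1⟩ := hφC ⟨x, hx.1⟩
  have hxc : ∀ c, Commute x c := by
    intro c
    have ha : c ∈ Subalgebra.toSubmodule B * Subalgebra.toSubmodule C := by rw [h.top]; trivial
    refine Submodule.mul_induction_on ha ?_ ?_
    · intro b hb c hc
      exact Commute.mul_right (h.1 b hb x hx.1).symm (hcomm x hx.1 c hc)
    · intro b c hb hc
      exact hb.add_right hc
  have hnil : IsNilpotent x := ⟨N + 1, by
    have : x ^ (N + 1) ∈ JJ C ^ (N + 1) := Submodule.pow_mem_pow _ hx _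
    rwa [hN, Submodule.mem_bot] at this⟩
  have hcoe : ∀ n : ℕ, ((φ x ^ n : C) : MonoidAlgebra (ZMod p) G) = x ^ n := by
    intro n
    rw [hφx]; rfl
  refine core (R := C) hG hindec hxc hnil (φ : MonoidAlgebra (ZMod p) G →+* C) ?_ ?_ ?_ ?_
  · intro c
    exact ⟨c, hφC c⟩
  · intro h0
    apply hx0
    have := hcoe 1
    rw [pow_one, pow_one] at this
    rw [← this]
    exact congrArg Subtype.val h0
  · intro n hn
    rw [← hcoe n]
    exact congrArg Subtype.val hn
  · intro a ha
    obtain ⟨q, hq⟩ := hpoly (φ a) (φ a).2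
    have hxa : aug p G x = 0 := hx.2
    have hr : Polynomial.aeval x q.divX ∈ C :=
      (Algebra.adjoin_le (Set.singleton_subset_iff.2 hx.1))
        (Polynomial.aeval_mem_adjoin_singleton _ _)
    have e : Polynomial.aeval x q =
        x * Polynomial.aeval x q.divX + algebraMap _ _ (q.coeff 0) := by
      conv_lhs => rw [← Polynomial.X_mul_divX_add q]
      rw [map_add, map_mul, Polynomial.aeval_X, Polynomial.aeval_C]
    have h0 : q.coeff 0 = 0 := by
      have h1 := h.aug_proj hφB hφC a
      rw [ha, ← hq, e, map_add, map_mul, hxa, zero_mul, zero_add, AlgHom.commutes] at h1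
      exact h1
    refine ⟨⟨_, hr⟩, Subtype.ext ?_⟩
    change (φ a : MonoidAlgebra (ZMod p) G) = (φ x : MonoidAlgebra (ZMod p) G) * _
    rw [← hq, e, h0, hφx, map_zero, add_zero]

lemma augI_le {S : Set G} (hS : Subgroup.closure S = ⊤) :
    augI p G ≤ Submodule.span (ZMod p) ((fun s => of (ZMod p) G s - 1) '' S) ⊔
      augI p G * augI p G := by
  set W := Submodule.span (ZMod p) ((fun s => of (ZMod p) G s - 1) '' S) ⊔
      augI p G * augI p G with hW
  have haug : ∀ g : G, of (ZMod p) G g - 1 ∈ augI p G := by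
    intro g; simp
  have hg : ∀ g : G, of (ZMod p) G g - 1 ∈ W := by
    intro g
    have : g ∈ Subgroup.closure S := by rw [hS]; trivial
    induction this using Subgroup.closure_induction with
    | mem s hs => exact Submodule.mem_sup_left (Submodule.subset_span ⟨s, hs, rfl⟩)
    | one => rw [map_one, sub_self]; exact W.zero_mem
    | mul g h _ _ ihg ihh =>
      have e : of (ZMod p) G (g * h) - 1 = (of (ZMod p) G g - 1) + (of (ZMod p) G h - 1) +
          (of (ZMod p) G g - 1) * (of (ZMod p) G h - 1) := by
        rw [map_mul]; noncomm_ring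
      rw [e]
      exact W.add_mem (W.add_mem ihg ihh)
        (Submodule.mem_sup_right (Submodule.mul_mem_mul (haug g) (haug h)))
    | inv g _ ihg =>
      have e0 : of (ZMod p) G g * of (ZMod p) G g⁻¹ = 1 := by
        rw [← map_mul, mul_inv_cancel, map_one]
      have e : of (ZMod p) G g⁻¹ - 1 = - (of (ZMod p) G g - 1) -
          (of (ZMod p) G g - 1) * (of (ZMod p) G g⁻¹ - 1) := by
        rw [mul_sub, sub_mul, e0]; noncomm_ring
      rw [e]
      exact W.sub_mem (W.neg_mem ihg)
        (Submodule.mem_sup_right (Submodule.mul_mem_mul (haug g) (haug _)))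
  have hall : ∀ a : MonoidAlgebra (ZMod p) G, a - algebraMap _ _ (aug p G a) ∈ W := by
    intro a
    induction a using MonoidAlgebra.induction_linear with
    | zero => simp
    | add a b ha hb =>
      have := W.add_mem ha hb
      rw [map_add, map_add]
      convert this using 1
      abel
    | single g r =>
      have := W.smul_mem r (hg g)
      convert this using 1
      rw [smul_sub, Algebra.algebraMap_eq_smul_one]
      simp
  intro a ha
  have h1 := hall a
  have h2 : aug p G a = 0 := ha
  rwa [h2, map_zero, sub_zero] at h1

/-- the cotangent space of `C` -/
noncomputable abbrev VV (C : Subalgebra (ZMod p) (MonoidAlgebra (ZMod p) G)) :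
    Submodule (ZMod p) (MonoidAlgebra (ZMod p) G ⧸ (JJ C * JJ C)) :=
  (JJ C).map (JJ C * JJ C).mkQ

lemma abs_rank {K A P Q ι : Type*} [Field K] [AddCommGroup A] [Module K A] [AddCommGroup P]
    [Module K P] [AddCommGroup Q] [Module K Q]
    (f : A →ₗ[K] P) (g : A →ₗ[K] Q) (I I2 : Submodule K A) (S : Finset ι) (u : ι → A)
    (hI : I ≤ Submodule.span K (u '' S) ⊔ I2) (hf : I2 ≤ LinearMap.ker f)
    (hg : I2 ≤ LinearMap.ker g) (V : Submodule K P) (W : Submodule K Q)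
    (hV : ∀ v ∈ V, ∀ w ∈ W, ∃ a ∈ I, f a = v ∧ g a = w) :
    Module.finrank K V + Module.finrank K W ≤ S.card := by
  classical
  have hTI : I.map (f.prod g) ≤ Submodule.span K
      ((S.image (fun s => f.prod g (u s)) : Finset (P × Q)) : Set (P × Q)) := by
    refine (Submodule.map_mono hI).trans ?_
    rw [Submodule.map_sup]
    refine sup_le ?_ ?_
    · rw [Submodule.map_span]
      apply Submodule.span_mono
      rintro _ ⟨_, ⟨s, hs, rfl⟩, rfl⟩
      rw [Finset.coe_image]
      exact ⟨s, hs, rfl⟩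
    · rintro _ ⟨a, ha, rfl⟩
      have : f.prod g a = 0 := Prod.ext (hf ha) (hg ha)
      rw [this]
      exact Submodule.zero_mem _
  let F : (V × W) →ₗ[K] Submodule.span K
      ((S.image (fun s => f.prod g (u s)) : Finset (P × Q)) : Set (P × Q)) :=
    (LinearMap.prodMap V.subtype W.subtype).codRestrict _ (fun v => hTI (by
      obtain ⟨a, ha, h1, h2⟩ := hV v.1 v.1.2 v.2 v.2.2
      exact ⟨a, ha, Prod.ext h1 h2⟩))
  have hF : Function.Injective F := by
    intro v w hvw
    have := congrArg Subtype.val hvw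
    exact Prod.ext (Subtype.ext (congrArg Prod.fst this)) (Subtype.ext (congrArg Prod.snd this))
  have hVf : Module.Finite K V := Module.Finite.of_injective (F ∘ₗ LinearMap.inl K V W)
    (hF.comp LinearMap.inl_injective)
  have hWf : Module.Finite K W := Module.Finite.of_injective (F ∘ₗ LinearMap.inr K V W)
    (hF.comp LinearMap.inr_injective)
  have h1 := LinearMap.finrank_le_finrank_of_injective hF
  rw [Module.finrank_prod] at h1
  exact h1.trans ((finrank_span_finset_le_card _).trans Finset.card_image_le)

lemma rank_le [Finite G] (h : Fact' B C) (S : Finset G)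
    (hS : Subgroup.closure (S : Set G) = ⊤) :
    Module.finrank (ZMod p) (VV B) + Module.finrank (ZMod p) (VV C) ≤ S.card := by
  obtain ⟨φ, hφB, hφC⟩ := h.proj
  obtain ⟨ψ, hψC, hψB⟩ := h.symm.proj
  have haφ := h.aug_proj hφB hφC
  have haψ := h.symm.aug_proj hψC hψB
  have hφJ : ∀ a ∈ augI p G, (φ a : MonoidAlgebra (ZMod p) G) ∈ JJ C :=
    fun a ha => mem_JJ.2 ⟨(φ a).2, (haφ a).trans ha⟩
  have hψJ : ∀ a ∈ augI p G, (ψ a : MonoidAlgebra (ZMod p) G) ∈ JJ B :=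
    fun a ha => mem_JJ.2 ⟨(ψ a).2, (haψ a).trans ha⟩
  refine abs_rank ((JJ B * JJ B).mkQ ∘ₗ (B.val.comp ψ).toLinearMap)
    ((JJ C * JJ C).mkQ ∘ₗ (C.val.comp φ).toLinearMap) (augI p G) (augI p G * augI p G) S
    (fun s => of (ZMod p) G s - 1) (augI_le hS) ?_ ?_ (VV B) (VV C) ?_
  · refine Submodule.mul_le.2 fun a ha b hb => ?_
    rw [LinearMap.mem_ker]
    change (JJ B * JJ B).mkQ ((ψ (a * b) : B) : MonoidAlgebra (ZMod p) G) = 0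
    rw [Submodule.mkQ_apply, Submodule.Quotient.mk_eq_zero, map_mul, Subalgebra.coe_mul]
    exact Submodule.mul_mem_mul (hψJ a ha) (hψJ b hb)
  · refine Submodule.mul_le.2 fun a ha b hb => ?_
    rw [LinearMap.mem_ker]
    change (JJ C * JJ C).mkQ ((φ (a * b) : C) : MonoidAlgebra (ZMod p) G) = 0
    rw [Submodule.mkQ_apply, Submodule.Quotient.mk_eq_zero, map_mul, Subalgebra.coe_mul]
    exact Submodule.mul_mem_mul (hφJ a ha) (hφJ b hb)
  · rintro _ ⟨b, hb, rfl⟩ _ ⟨c, hc, rfl⟩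
    have hb0 : aug p G b = 0 := hb.2
    have hc0 : aug p G c = 0 := hc.2
    have h1 : ψ (b + c) = ⟨b, hb.1⟩ := by
      rw [map_add, hψC c hc.1, hc0, map_zero, add_zero]
      exact hψB ⟨b, hb.1⟩
    have h2 : φ (b + c) = ⟨c, hc.1⟩ := by
      rw [map_add, hφB b hb.1, hb0, map_zero, zero_add]
      exact hφC ⟨c, hc.1⟩
    refine ⟨b + c, (augI p G).add_mem hb.2 hc.2, ?_, ?_⟩
    · change (JJ B * JJ B).mkQ ((ψ (b + c) : B) : MonoidAlgebra (ZMod p) G) = _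
      rw [h1]
    · change (JJ C * JJ C).mkQ ((φ (b + c) : C) : MonoidAlgebra (ZMod p) G) = _
      rw [h2]

lemma rank_pos [Finite G] (hG : IsPGroup p G) (hC : C ≠ ⊥) :
    1 ≤ Module.finrank (ZMod p) (VV C) := by
  have := finite_alg p G
  by_contra hlt
  have h0 : Module.finrank (ZMod p) (VV C) = 0 := by omega
  rw [Submodule.finrank_eq_zero] at h0
  apply JJ_not_le hG hC
  have h1 := LinearMap.le_ker_iff_map.2 h0
  rwa [Submodule.ker_mkQ] at h1

lemma exists_gen [Finite G] (hC : Module.finrank (ZMod p) (VV C) ≤ 1) :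
    ∃ x ∈ JJ C, JJ C ≤ Submodule.span (ZMod p) {x} ⊔ JJ C * JJ C := by
  have := finite_alg p G
  obtain ⟨⟨_, x, hx, rfl⟩, hv⟩ := finrank_le_one_iff.1 hC
  refine ⟨x, hx, fun a ha => ?_⟩
  obtain ⟨c, hc⟩ := hv ⟨_, a, ha, rfl⟩
  have h1 : c • (JJ C * JJ C).mkQ x = (JJ C * JJ C).mkQ a := congrArg Subtype.val hc
  rw [← map_smul, ← sub_eq_zero, ← map_sub, Submodule.mkQ_apply,
    Submodule.Quotient.mk_eq_zero] at h1
  have e : a = c • x + -(c • x - a) := by abel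
  rw [e]
  exact Submodule.add_mem_sup (Submodule.smul_mem _ _ (Submodule.mem_span_singleton_self x))
    (Submodule.neg_mem _ h1)

end Stmt18
/-- Let `G` be a finite `p`-group, indecomposable as a direct product of
nontrivial subgroups, which can be generated by `3` elements. Then `F_pG` admits no
tensor factorization `F_pG = B ⊗ C` with `B` and `C` proper subalgebras. -/
theorem stmt18 (p : ℕ) [Fact p.Prime]
    (G : Type*) [Group G] [Finite G] (hG : IsPGroup p G)
    (hindec : ∀ H K : Subgroup G, H.Normal → K.Normal →
      Disjoint H K → H ⊔ K = ⊤ → H = ⊥ ∨ K = ⊥)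
    (hgen : ∃ S : Finset G, S.card ≤ 3 ∧ Subgroup.closure (S : Set G) = ⊤) :
    ¬∃ B C : Subalgebra (ZMod p) (MonoidAlgebra (ZMod p) G),
      (∀ b ∈ B, ∀ c ∈ C, Commute b c) ∧
      Function.Bijective
        (Submodule.mulMap (Subalgebra.toSubmodule B) (Subalgebra.toSubmodule C)) ∧
      B ≠ ⊥ ∧ C ≠ ⊥ := by
  rintro ⟨B, C, hcomm, hbij, hB, hC⟩
  obtain ⟨S, hS3, hS⟩ := hgen
  have h : Stmt18.Fact' B C := ⟨hcomm, hbij⟩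
  have h1 := Stmt18.rank_le h S hS
  have hB1 := Stmt18.rank_pos hG hB
  have hC1 := Stmt18.rank_pos hG hC
  obtain ⟨z, hz⟩ : ∃ z : G, Subgroup.zpowers z = ⊤ := by
    by_cases hc : Module.finrank (ZMod p) (Stmt18.VV C) ≤ 1
    · obtain ⟨x, hx, hJ⟩ := Stmt18.exists_gen hc
      exact Stmt18.half hG hindec h hC hx hJ
    · obtain ⟨x, hx, hJ⟩ := Stmt18.exists_gen (C := B) (by omega)
      exact Stmt18.half hG hindec h.symm hB hx hJ
  have h2 := Stmt18.rank_le h {z} (by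
    rw [Finset.coe_singleton, ← Subgroup.zpowers_eq_closure, hz])
  rw [Finset.card_singleton] at h2
  omega
end

section
/- Let G be a finite p-group that is indecomposable as a direct product of nontrivial subgroups and suppose the derived subgroup G' is cyclic. Then F_pG admits no factorization F_pG = B ⊗ C with B and C proper subalgebras. (Key step: if F_pG = B ⊗ C with G' cyclic, then since I(G')F_pG / I(G')I(G) is one-dimensional and spanned by a single commutator, one of B, C must be commutative.) -/
namespace TF
open MonoidAlgebra

variable {p : ℕ} [hp : Fact p.Prime] {G : Type*} [Group G]

theorem sum_class_zero [Fintype G] (hG : IsPGroup p G) {M : Type*} [AddCommMonoid M]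
    (hM : ∀ m : M, p • m = 0) (f : G → M) (hconj : ∀ x g, f (x * g * x⁻¹) = f g)
    (hz : ∀ g ∈ Subgroup.center G, f g = 0) : ∑ g, f g = 0 := by
  classical
  have h := Finset.sum_comp (s := (Finset.univ : Finset G)) (fun m : M => m) f
  rw [h]
  refine Finset.sum_eq_zero fun m _ => ?_
  by_cases hm : m = 0
  · simp [hm]
  let S : SubMulAction (ConjAct G) G :=
    { carrier := {g | f g = m}
      smul_mem' := by
        intro x g hg
        simp only [Set.mem_ofPred_eq] at hg ⊢
        rw [ConjAct.smul_def, hconj, hg] }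
  have hd : p ∣ Nat.card S := by
    by_contra hd
    have hG' : IsPGroup p (ConjAct G) := hG.of_equiv (ConjAct.toConjAct (G := G))
    obtain ⟨⟨g, hg⟩, hfix⟩ := hG'.nonempty_fixed_point_of_prime_not_dvd_card S hd
    apply hm
    have hg' : f g = m := hg
    rw [← hg']
    apply hz
    rw [Subgroup.mem_center_iff]
    intro x
    have := congrArg Subtype.val (hfix (ConjAct.toConjAct x))
    rw [SubMulAction.val_smul, ConjAct.smul_def] at this
    simp only [ConjAct.ofConjAct_toConjAct] at this
    rw [mul_inv_eq_iff_eq_mul] at this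
    exact this
  have hc : Nat.card S = (Finset.univ.filter fun a => f a = m).card := by
    rw [Nat.card_eq_fintype_card, Fintype.card_subtype]
    rfl
  rw [hc] at hd
  obtain ⟨k, hk⟩ := hd
  rw [hk, mul_comm, mul_nsmul', hM, smul_zero]

/-- augmentation -/
noncomputable def aug (p : ℕ) (G : Type*) [Group G] : MonoidAlgebra (ZMod p) G →ₐ[ZMod p] ZMod p :=
  MonoidAlgebra.lift (ZMod p) (ZMod p) G 1

@[simp] theorem aug_single (g : G) (r : ZMod p) : aug p G (single g r) = r := by
  simp [aug]

theorem aug_eq_sum [Fintype G] (a : MonoidAlgebra (ZMod p) G) : aug p G a = ∑ g, a.coeff g := by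
  simp [aug, MonoidAlgebra.lift_apply, Finsupp.sum_fintype]

theorem finA [Finite G] : Finite (MonoidAlgebra (ZMod p) G) :=
  Finite.of_injective _ (DFunLike.coe_injective.comp (coeff_injective (R := ZMod p) (M := G)))

theorem mul_inj_of_aug [Finite G] (hG : IsPGroup p G) (a : MonoidAlgebra (ZMod p) G)
    (ha : aug p G a ≠ 0) (v : MonoidAlgebra (ZMod p) G) (hv : v * a = 0) : v = 0 := by
  classical
  have := Fintype.ofFinite G
  have := finA (p := p) (G := G)
  by_contra hv0
  let S : Submodule (ZMod p) (MonoidAlgebra (ZMod p) G) := LinearMap.ker (LinearMap.mulRight (ZMod p) a)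
  have hS : ∀ w, w ∈ S ↔ w * a = 0 := fun w => by simp [S]
  let _inst : MulAction G S :=
    { smul := fun g w => ⟨single g 1 * w.1, by rw [hS, mul_assoc, (hS _).1 w.2, mul_zero]⟩
      one_smul := fun w => Subtype.ext (by
        change single 1 1 * w.1 = w.1
        rw [← one_def, one_mul])
      mul_smul := fun g h w => Subtype.ext (by
        change single (g * h) 1 * w.1 = single g 1 * (single h 1 * w.1)
        rw [← mul_assoc, single_mul_single, one_mul]) }
  have hsm : ∀ (g : G) (w : S), (g • w).1 = single g 1 * w.1 := fun _ _ => rfl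
  have hcard : p ∣ Nat.card S := by
    have : Nontrivial S := ⟨⟨⟨v, (hS v).2 hv⟩, 0, fun h => hv0 (congrArg Subtype.val h)⟩⟩
    rw [Module.natCard_eq_pow_finrank (K := ZMod p) (V := S), Nat.card_zmod]
    exact dvd_pow_self _ (Module.finrank_pos).ne'
  have h0 : (0 : S) ∈ MulAction.fixedPoints G S := fun g => Subtype.ext (by rw [hsm]; simp)
  obtain ⟨⟨w, hw⟩, hfix, hne⟩ := hG.exists_fixed_point_of_prime_dvd_card_of_fixed_point S hcard h0
  have hc : ∀ g, w.coeff g = w.coeff 1 := by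
    intro g
    have := congrArg Subtype.val (hfix g)
    rw [hsm] at this
    simp only at this
    conv_lhs => rw [← this]
    rw [coeff_single_mul_apply]; simp
  have h1 : (w * a).coeff 1 = w.coeff 1 * aug p G a := by
    rw [coeff_mul_apply_right, Finsupp.sum_fintype _ _ (by simp), aug_eq_sum, Finset.mul_sum]
    refine Finset.sum_congr rfl fun g _ => ?_
    rw [hc]
  rw [(hS w).1 hw] at h1
  have h2 : w.coeff 1 = 0 := by
    simpa [ha] using h1.symm
  apply hne
  apply Subtype.ext
  change 0 = w
  ext g
  rw [hc, h2]; simp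

theorem isUnit_of_aug [Finite G] (hG : IsPGroup p G) (a : MonoidAlgebra (ZMod p) G)
    (ha : aug p G a ≠ 0) : IsUnit a := by
  have := finA (p := p) (G := G)
  have hinj : Function.Injective (fun v : MonoidAlgebra (ZMod p) G => v * a) := by
    intro v w h
    rw [← sub_eq_zero]
    refine mul_inj_of_aug hG a ha _ ?_
    rw [sub_mul, sub_eq_zero]; exact h
  obtain ⟨b, hb⟩ := (Finite.injective_iff_surjective.1 hinj) 1
  have hb : b * a = 1 := hb
  refine ⟨⟨a, b, ?_, hb⟩, rfl⟩
  apply hinj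
  change a * b * a = 1 * a
  rw [mul_assoc, hb]; simp

theorem nilp_of_aug [Finite G] (hG : IsPGroup p G) (a : MonoidAlgebra (ZMod p) G)
    (ha : aug p G a = 0) : ∃ n : ℕ, a ^ n = 0 := by
  have := finA (p := p) (G := G)
  obtain ⟨m, n, hmn, h⟩ := Finite.exists_ne_map_eq_of_infinite (fun n : ℕ => a ^ n)
  wlog hlt : m < n generalizing m n
  · exact this n m hmn.symm h.symm (by omega)
  refine ⟨m, ?_⟩
  obtain ⟨d, rfl⟩ := Nat.exists_eq_add_of_lt hlt
  refine mul_inj_of_aug hG (1 - a ^ (d + 1)) ?_ _ ?_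
  · simp [ha]
  · rw [mul_sub, ← pow_add, ← add_assoc, mul_one, h, sub_self]

theorem nilp_uniform [Finite G] (hG : IsPGroup p G) :
    ∃ n : ℕ, ∀ a : MonoidAlgebra (ZMod p) G, aug p G a = 0 → a ^ p ^ n = 0 := by
  classical
  have := finA (p := p) (G := G)
  have := Fintype.ofFinite (MonoidAlgebra (ZMod p) G)
  have h : ∀ a : MonoidAlgebra (ZMod p) G, ∃ n : ℕ, aug p G a = 0 → a ^ n = 0 := fun a => by
    by_cases ha : aug p G a = 0
    · obtain ⟨n, hn⟩ := nilp_of_aug hG a ha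
      exact ⟨n, fun _ => hn⟩
    · exact ⟨0, fun h => absurd h ha⟩
  choose f hf using h
  refine ⟨Finset.univ.sup f, fun a ha => pow_eq_zero_of_le ?_ (hf a ha)⟩
  exact (Finset.le_sup (Finset.mem_univ a)).trans (Nat.lt_pow_self hp.out.one_lt).le

theorem sum_pow_comm {R ι : Type*} [Ring R] [CharP R p] (s : Finset ι) (f : ι → R)
    (hf : ∀ i j, Commute (f i) (f j)) (n : ℕ) :
    (∑ i ∈ s, f i) ^ p ^ n = ∑ i ∈ s, f i ^ p ^ n := by
  classical
  induction s using Finset.induction_on with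
  | empty => simp [hp.out.ne_zero]
  | insert i s hi ih =>
    rw [Finset.sum_insert hi, Finset.sum_insert hi, ← ih]
    exact add_pow_char_pow_of_commute _ _ (Commute.sum_right _ _ _ fun j _ => hf i j)

theorem split_off
    (hindec : ∀ H K : Subgroup G, H.Normal → K.Normal →
      Disjoint H K → H ⊔ K = ⊤ → H = ⊥ ∨ K = ⊥)
    {H : Type*} [CommGroup H] [Finite H] (χ : G →* H) (m : ℕ)
    (hexp : ∀ h : H, h ^ p ^ (m + 1) = 1) (z : G) (hz : z ∈ Subgroup.center G)
    (hz1 : z ^ p ^ (m + 1) = 1) (hz2 : χ z ^ p ^ m ≠ 1) : ∀ g, g ∈ Subgroup.zpowers z := by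
  have : NeZero (Monoid.exponent H) := ⟨Monoid.exponent_ne_zero_of_finite⟩
  obtain ⟨θ, hθ⟩ := CommGroup.exists_apply_ne_one_of_hasEnoughRootsOfUnity H ℂ hz2
  let ψ : G →* ℂˣ := θ.comp χ
  have hψ : ψ z ^ p ^ m ≠ 1 := by simpa [ψ] using hθ
  have hψ' : ∀ g, ψ g ^ p ^ (m + 1) = 1 := fun g => by
    simp only [ψ, MonoidHom.comp_apply]
    rw [← map_pow, hexp, map_one]
  have hord : orderOf (ψ z) = p ^ (m + 1) :=
    orderOf_eq_prime_pow hψ (hψ' z)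
  have hprim : IsPrimitiveRoot (ψ z) (p ^ (m + 1)) := hord ▸ IsPrimitiveRoot.orderOf _
  have hordz : orderOf z = p ^ (m + 1) := by
    apply Nat.dvd_antisymm (orderOf_dvd_of_pow_eq_one hz1)
    rw [← hord]; exact orderOf_map_dvd _ _
  have hnz : (Subgroup.zpowers z).Normal := by
    refine ⟨fun n hn g => ?_⟩
    obtain ⟨k, rfl⟩ := hn
    have : Commute g (z ^ k) := Commute.zpow_right (Subgroup.mem_center_iff.1 hz g) k
    rw [this.eq, mul_inv_cancel_right]
    exact ⟨k, rfl⟩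
  have : NeZero (p ^ (m + 1)) := ⟨pow_ne_zero _ hp.out.ne_zero⟩
  have key : ∀ g, ∃ k : ℕ, ψ z ^ k = ψ g := by
    intro g
    obtain ⟨k, _, hk⟩ := (hprim.map_of_injective (f := Units.coeHom ℂ)
      Units.val_injective).eq_pow_of_pow_eq_one (ξ := (ψ g : ℂ))
      (by rw [← Units.val_pow_eq_pow_val, hψ', Units.val_one])
    exact ⟨k, Units.ext (by simpa using hk)⟩
  have hdisj : Disjoint (Subgroup.zpowers z) ψ.ker := by
    rw [Subgroup.disjoint_def]
    rintro x ⟨k, rfl⟩ hx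
    simp only [MonoidHom.mem_ker, map_zpow] at hx ⊢
    rw [← orderOf_dvd_iff_zpow_eq_one, hord] at hx
    rw [← orderOf_dvd_iff_zpow_eq_one, hordz]
    exact hx
  have hsup : Subgroup.zpowers z ⊔ ψ.ker = ⊤ := by
    rw [eq_top_iff]
    intro g _
    obtain ⟨k, hk'⟩ := key g
    have : (z ^ k)⁻¹ * g ∈ ψ.ker := by
      rw [MonoidHom.mem_ker, map_mul, map_inv, map_pow, hk', inv_mul_cancel]
    have h2 := Subgroup.mul_mem_sup (S := Subgroup.zpowers z) (T := ψ.ker) ⟨k, zpow_natCast z k⟩ this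
    rwa [mul_inv_cancel_left] at h2
  rcases hindec (Subgroup.zpowers z) ψ.ker hnz inferInstance hdisj hsup with h | h
  · exfalso
    rw [Subgroup.zpowers_eq_bot] at h
    apply hψ; simp [h]
  · intro g
    rw [h, sup_bot_eq] at hsup
    rw [hsup]; trivial


theorem central_coeff (c : MonoidAlgebra (ZMod p) G) (hc : ∀ a, Commute c a) (x g : G) :
    c.coeff (x * g * x⁻¹) = c.coeff g := by
  have h := congrArg (fun t => t.coeff (x * g)) (hc (single x 1)).eq
  simp only [coeff_mul_single_apply, coeff_single_mul_apply] at h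
  simpa using h

theorem mul_coeff_central [Finite G] (hG : IsPGroup p G) (a c : MonoidAlgebra (ZMod p) G)
    (ha : ∀ b, Commute a b) (hc : ∀ b, Commute c b)
    (hc0 : ∀ g ∈ Subgroup.center G, c.coeff g = 0) (u : G) (hu : u ∈ Subgroup.center G) :
    (a * c).coeff u = 0 := by
  classical
  have := Fintype.ofFinite G
  rw [coeff_mul_apply_right, Finsupp.sum_fintype _ _ (by simp)]
  apply sum_class_zero hG (by intro m; simp)
  · intro x g
    have h1 : u * (x * g * x⁻¹)⁻¹ = x * (u * g⁻¹) * x⁻¹ := by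
      have := Subgroup.mem_center_iff.1 hu x
      simp only [mul_inv_rev, inv_inv]
      rw [← mul_assoc, ← mul_assoc, ← mul_assoc, this]
    rw [central_coeff c hc, h1, central_coeff a ha]
  · intro g hg
    rw [hc0 g hg, mul_zero]

theorem exists_central [Finite G] (hG : IsPGroup p G)
    (φ : MonoidAlgebra (ZMod p) G →ₐ[ZMod p] MonoidAlgebra (ZMod p) G)
    (hφ : ∀ a b, Commute (φ a) (φ b)) (c : MonoidAlgebra (ZMod p) G) (hc : ∀ b, Commute c b)
    (m : ℕ) (h1 : (φ c) ^ p ^ m ≠ 0) (h2 : c ^ p ^ (m + 1) = 0) :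
    ∃ z ∈ Subgroup.center G, z ^ p ^ (m + 1) = 1 ∧ φ (single z 1) ^ p ^ m ≠ 1 := by
  classical
  have := Fintype.ofFinite G
  have hch : CharP (MonoidAlgebra (ZMod p) G) p :=
    charP_of_injective_algebraMap (algebraMap (ZMod p) (MonoidAlgebra (ZMod p) G)).injective p
  by_contra! hcon
  let Z : Finset G := Finset.univ.filter (· ∈ Subgroup.center G)
  have hZ : ∀ z, z ∈ Z ↔ z ∈ Subgroup.center G := fun z => by simp [Z]
  let F : G → MonoidAlgebra (ZMod p) G := fun z =>
    if z ∈ Subgroup.center G then single z (c.coeff z) else 0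
  have hFc : ∀ z b, Commute (F z) b := by
    intro z b
    by_cases hz : z ∈ Subgroup.center G
    · simp only [F, hz, if_true]
      exact single_commute (fun g => (Subgroup.mem_center_iff.1 hz g).symm)
        (fun r => Commute.all _ _) b
    · simp only [F, hz, if_false]; exact Commute.zero_left _
  let c0 : MonoidAlgebra (ZMod p) G := ∑ z, F z
  let c1 := c - c0
  have hc0c : ∀ b, Commute c0 b := fun b => Commute.sum_left _ _ _ fun z _ => hFc z b
  have hc1c : ∀ b, Commute c1 b := fun b => (hc b).sub_left (hc0c b)
  have hc0coeff : ∀ g, c0.coeff g = if g ∈ Subgroup.center G then c.coeff g else 0 := by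
    intro g
    simp only [c0, coeff_sum, Finsupp.finsetSum_apply]
    rw [Finset.sum_eq_single g]
    · by_cases hg : g ∈ Subgroup.center G <;> simp [F, hg]
    · intro b _ hb
      by_cases hz : b ∈ Subgroup.center G <;> simp [F, hz, hb]
    · simp
  have hc1coeff : ∀ g, c1.coeff g = if g ∈ Subgroup.center G then 0 else c.coeff g := by
    intro g
    simp only [c1, coeff_sub, Finsupp.sub_apply, hc0coeff]
    split_ifs <;> simp
  have hφc1 : φ c1 = 0 := by
    have h : φ c1 = ∑ g, c1.coeff g • φ (single g 1) := by
      conv_lhs => rw [← sum_coeff_single c1]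
      rw [Finsupp.sum_fintype _ _ (by simp), map_sum]
      refine Finset.sum_congr rfl fun g _ => ?_
      rw [← map_smul, smul_single', mul_one]
    rw [h]
    apply sum_class_zero hG
    · intro b
      rw [← Nat.cast_smul_eq_nsmul (ZMod p)]; simp
    · intro x g
      rw [central_coeff c1 hc1c]
      congr 1
      have e : (single (x * g * x⁻¹) 1 : MonoidAlgebra (ZMod p) G)
          = single x 1 * single g 1 * single x⁻¹ 1 := by simp [single_mul_single]
      rw [e, map_mul, map_mul, (hφ (single x 1) _).eq, mul_assoc, ← map_mul]
      simp [single_mul_single, ← one_def]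
    · intro g hg
      rw [hc1coeff, if_pos hg, zero_smul]
  have hpow : ∀ n, c0 ^ p ^ n =
      ∑ z, if z ∈ Subgroup.center G then single (z ^ p ^ n) (c.coeff z) else 0 := by
    intro n
    rw [sum_pow_comm _ _ (fun i j => hFc i _)]
    refine Finset.sum_congr rfl fun z _ => ?_
    by_cases hz : z ∈ Subgroup.center G
    · simp [F, hz, single_pow, ZMod.pow_card_pow]
    · simp [F, hz, hp.out.ne_zero]
  have hvan : ∀ u ∈ Subgroup.center G, (c0 ^ p ^ (m + 1)).coeff u = 0 := by
    intro u hu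
    have e : c0 ^ p ^ (m + 1) = - (c1 ^ p ^ (m + 1)) := by
      have : c ^ p ^ (m + 1) = c0 ^ p ^ (m + 1) + c1 ^ p ^ (m + 1) := by
        rw [← add_pow_char_pow_of_commute _ _ (hc0c c1)]
        simp [c1]
      rw [h2] at this
      exact eq_neg_of_add_eq_zero_left this.symm
    obtain ⟨k, hk⟩ := Nat.exists_eq_succ_of_ne_zero (pow_ne_zero (m + 1) hp.out.ne_zero)
    rw [e, hk, pow_succ, coeff_neg, Finsupp.neg_apply,
      mul_coeff_central hG _ c1 (fun b => (hc1c b).pow_left _) hc1c _ u hu, neg_zero]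
    intro g hg
    rw [hc1coeff, if_pos hg]
  apply h1
  have e1 : φ c = φ c0 := by
    have : c = c0 + c1 := by simp [c1]
    rw [this, map_add, hφc1, add_zero]
  rw [e1, ← map_pow, hpow, map_sum,
    ← Finset.sum_fiberwise Finset.univ (fun z : G => z ^ p ^ (m + 1))]
  refine Finset.sum_eq_zero fun u _ => ?_
  rw [← Finset.sum_filter_add_sum_filter_not _ (fun z => z ∈ Subgroup.center G)]
  rw [Finset.sum_eq_zero (s := Finset.filter (fun z => ¬ z ∈ Subgroup.center G) _)
    (fun z hz => by simp [(Finset.mem_filter.1 hz).2]), add_zero]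
  by_cases hne : ∃ z0, z0 ∈ Subgroup.center G ∧ z0 ^ p ^ (m + 1) = u
  · obtain ⟨z0, hz0, hz0u⟩ := hne
    have hv := hvan u (hz0u ▸ Subgroup.pow_mem _ hz0 _)
    rw [hpow, coeff_sum, Finsupp.finsetSum_apply,
      ← Finset.sum_fiberwise Finset.univ (fun z : G => z ^ p ^ (m + 1)),
      Finset.sum_eq_single u, ← Finset.sum_filter_add_sum_filter_not _ (fun z => z ∈ Subgroup.center G),
      Finset.sum_eq_zero (s := Finset.filter (fun z => ¬ z ∈ Subgroup.center G) _)
      (fun z hz => by simp [(Finset.mem_filter.1 hz).2]), add_zero] at hv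
    · have hv' : ∑ z ∈ (Finset.univ.filter fun z : G => z ^ p ^ (m + 1) = u).filter
          (fun z => z ∈ Subgroup.center G), c.coeff z = 0 := by
        rw [← hv]
        refine Finset.sum_congr rfl fun z hz => ?_
        simp only [Finset.mem_filter, Finset.mem_univ, true_and] at hz
        simp [hz.1, hz.2]
      have : ∀ z ∈ (Finset.univ.filter fun z : G => z ^ p ^ (m + 1) = u).filter
          (fun z => z ∈ Subgroup.center G),
          φ (if z ∈ Subgroup.center G then single (z ^ p ^ m) (c.coeff z) else 0)
          = c.coeff z • φ (single (z0 ^ p ^ m) 1) := by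
        intro z hz
        simp only [Finset.mem_filter, Finset.mem_univ, true_and] at hz
        obtain ⟨hzu, hzc⟩ := hz
        have hw : z * z0⁻¹ ∈ Subgroup.center G := mul_mem hzc (inv_mem hz0)
        have hcomm : Commute z z0⁻¹ := (Subgroup.mem_center_iff.1 hzc _).symm
        have hw1 := hcon _ hw (by
          rw [hcomm.mul_pow, inv_pow, hzu, hz0u, mul_inv_cancel])
        rw [← map_pow, single_pow, one_pow, hcomm.mul_pow] at hw1
        have e : (single (z ^ p ^ m) 1 : MonoidAlgebra (ZMod p) G)
            = single (z ^ p ^ m * z0⁻¹ ^ p ^ m) 1 * single (z0 ^ p ^ m) 1 := by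
          rw [single_mul_single]; simp
        rw [if_pos hzc]
        have e2 : (single (z ^ p ^ m) (c.coeff z) : MonoidAlgebra (ZMod p) G)
            = c.coeff z • single (z ^ p ^ m) 1 := by simp
        rw [e2, map_smul, e, map_mul, hw1, one_mul]
      rw [Finset.sum_congr rfl this, ← Finset.sum_smul, hv', zero_smul]
    · intro b _ hb
      refine Finset.sum_eq_zero fun z hz => ?_
      simp only [Finset.mem_filter, Finset.mem_univ, true_and] at hz
      by_cases hzc : z ∈ Subgroup.center G <;> simp [hzc, hz, hb]
    · simp
  · rw [Finset.sum_eq_zero]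
    intro z hz
    simp only [Finset.mem_filter, Finset.mem_univ, true_and] at hz
    exact absurd ⟨z, hz.2, hz.1⟩ hne


/-- Data extracted from a tensor factorization. -/
structure Fac (B C : Subalgebra (ZMod p) (MonoidAlgebra (ZMod p) G))
    (φ ψ : MonoidAlgebra (ZMod p) G →ₐ[ZMod p] MonoidAlgebra (ZMod p) G) : Prop where
  comm : ∀ b ∈ B, ∀ c ∈ C, Commute b c
  gen : ∀ P : MonoidAlgebra (ZMod p) G → Prop, (∀ b ∈ B, ∀ c ∈ C, P (b * c)) →
    (∀ x y, P x → P y → P (x + y)) → ∀ a, P a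
  φB : ∀ b ∈ B, φ b = b
  φC : ∀ c ∈ C, φ c = algebraMap _ _ (aug p G c)
  ψC : ∀ c ∈ C, ψ c = c
  ψB : ∀ b ∈ B, ψ b = algebraMap _ _ (aug p G b)

theorem Fac.symm {B C : Subalgebra (ZMod p) (MonoidAlgebra (ZMod p) G)} {φ ψ}
    (h : Fac B C φ ψ) : Fac C B ψ φ where
  comm := fun b hb c hc => (h.comm c hc b hb).symm
  gen := fun P h1 h2 a => h.gen P (fun b hb c hc => by
    rw [(h.comm b hb c hc).eq]; exact h1 c hc b hb) h2 a
  φB := h.ψC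
  φC := h.ψB
  ψC := h.φB
  ψB := h.φC

theorem Fac.memψ {B C : Subalgebra (ZMod p) (MonoidAlgebra (ZMod p) G)} {φ ψ}
    (h : Fac B C φ ψ) (a) : ψ a ∈ C := by
  refine h.gen (fun a => ψ a ∈ C) ?_ ?_ a
  · intro b hb c hc
    rw [map_mul, h.ψB b hb, h.ψC c hc]
    exact mul_mem (C.algebraMap_mem _) hc
  · intro x y hx hy
    rw [map_add]; exact add_mem hx hy

theorem Fac.augψ {B C : Subalgebra (ZMod p) (MonoidAlgebra (ZMod p) G)} {φ ψ}
    (h : Fac B C φ ψ) (a) : aug p G (ψ a) = aug p G a := by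
  refine h.gen (fun a => aug p G (ψ a) = aug p G a) ?_ ?_ a
  · intro b hb c hc
    rw [map_mul, h.ψB b hb, h.ψC c hc, map_mul, map_mul, AlgHom.commutes]; rfl
  · intro x y hx hy
    rw [map_add, map_add, map_add, hx, hy]

theorem exists_maps {k A : Type*} [Field k] [Ring A] [Algebra k A] (ε : A →ₐ[k] k)
    (B C : Subalgebra k A) (h1 : ∀ b ∈ B, ∀ c ∈ C, Commute b c)
    (h2 : Function.Bijective
        (Submodule.mulMap (Subalgebra.toSubmodule B) (Subalgebra.toSubmodule C))) :
    (∀ P : A → Prop, (∀ b ∈ B, ∀ c ∈ C, P (b * c)) →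
    (∀ x y, P x → P y → P (x + y)) → ∀ a, P a) ∧
    ∃ φ ψ : A →ₐ[k] A, (∀ b ∈ B, φ b = b) ∧ (∀ c ∈ C, φ c = algebraMap _ _ (ε c)) ∧
      (∀ c ∈ C, ψ c = c) ∧ (∀ b ∈ B, ψ b = algebraMap _ _ (ε b)) := by
  let m : TensorProduct k B C →ₐ[k] A :=
    Algebra.TensorProduct.lift B.val C.val (fun x y => h1 x x.2 y y.2)
  have hmt : ∀ (x : B) (y : C), m (x ⊗ₜ[k] y) = x.1 * y.1 :=
    fun x y => Algebra.TensorProduct.lift_tmul _ _ _ x y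
  have hm : ∀ t, m t = Submodule.mulMap (Subalgebra.toSubmodule B) (Subalgebra.toSubmodule C) t := by
    intro t
    induction t using TensorProduct.induction_on with
    | zero => rw [map_zero]; exact (map_zero _).symm
    | tmul x y => rw [hmt]; rfl
    | add x y hx hy => rw [map_add, hx, hy]; exact (map_add _ _ _).symm
  have hbij : Function.Bijective m := by
    have : (m : _ → _) = Submodule.mulMap (Subalgebra.toSubmodule B) (Subalgebra.toSubmodule C) :=
      funext hm
    rw [this]; exact h2
  let e := AlgEquiv.ofBijective m hbij
  have hsym : ∀ (b : B) (c : C), e.symm (b.1 * c.1) = b ⊗ₜ[k] c := by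
    intro b c
    rw [AlgEquiv.symm_apply_eq]
    exact (hmt b c).symm
  have hb : ∀ b : B, e.symm b.1 = b ⊗ₜ[k] 1 := fun b => by
    have := hsym b 1
    rwa [OneMemClass.coe_one, mul_one] at this
  have hc : ∀ c : C, e.symm c.1 = 1 ⊗ₜ[k] c := fun c => by
    have := hsym 1 c
    rwa [OneMemClass.coe_one, one_mul] at this
  let φ' : TensorProduct k B C →ₐ[k] A := Algebra.TensorProduct.lift B.val
    ((Algebra.ofId k A).comp (ε.comp C.val))
    (fun x y => (Algebra.commutes _ _).symm)
  let ψ' : TensorProduct k B C →ₐ[k] A := Algebra.TensorProduct.lift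
    ((Algebra.ofId k A).comp (ε.comp B.val)) C.val
    (fun x y => (Algebra.commutes _ _))
  have hφ' : ∀ (x : B) (y : C), φ' (x ⊗ₜ[k] y) = x.1 * algebraMap k A (ε y.1) :=
    fun x y => Algebra.TensorProduct.lift_tmul _ _ _ x y
  have hψ' : ∀ (x : B) (y : C), ψ' (x ⊗ₜ[k] y) = algebraMap k A (ε x.1) * y.1 :=
    fun x y => Algebra.TensorProduct.lift_tmul _ _ _ x y
  refine ⟨?_, φ'.comp e.symm.toAlgHom, ψ'.comp e.symm.toAlgHom, ?_, ?_, ?_, ?_⟩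
  · intro P hP hadd a
    obtain ⟨t, rfl⟩ := hbij.2 a
    induction t using TensorProduct.induction_on with
    | zero =>
      rw [map_zero]
      have := hP 0 (zero_mem _) 0 (zero_mem _)
      rwa [mul_zero] at this
    | tmul x y => rw [hmt]; exact hP x.1 x.2 y.1 y.2
    | add x y hx hy => rw [map_add]; exact hadd _ _ hx hy
  · intro b hb'
    change φ' (e.symm b) = b
    rw [hb ⟨b, hb'⟩, hφ']; simp
  · intro b hb'
    change φ' (e.symm b) = _
    rw [hc ⟨b, hb'⟩, hφ']; simp
  · intro b hb'
    change ψ' (e.symm b) = _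
    rw [hc ⟨b, hb'⟩, hψ']; simp
  · intro b hb'
    change ψ' (e.symm b) = _
    rw [hb ⟨b, hb'⟩, hψ']; simp

theorem exists_fac (B C : Subalgebra (ZMod p) (MonoidAlgebra (ZMod p) G))
    (h1 : ∀ b ∈ B, ∀ c ∈ C, Commute b c)
    (h2 : Function.Bijective
        (Submodule.mulMap (Subalgebra.toSubmodule B) (Subalgebra.toSubmodule C))) :
    ∃ φ ψ, Fac B C φ ψ := by
  obtain ⟨hg, φ, ψ, ha, hb, hc, hd⟩ := exists_maps (aug p G) B C h1 h2
  exact ⟨φ, ψ, h1, hg, ha, hb, hc, hd⟩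

open scoped commutatorElement in
theorem Fac.comm_or [Finite G] (hG : IsPGroup p G) (hcyc : IsCyclic (commutator G))
    {B C : Subalgebra (ZMod p) (MonoidAlgebra (ZMod p) G)} {φ ψ} (h : Fac B C φ ψ) :
    (∀ b ∈ B, ∀ b' ∈ B, Commute b b') ∨ (∀ c ∈ C, ∀ c' ∈ C, Commute c c') := by
  by_contra! hcon
  obtain ⟨⟨b1, hb1, b2, hb2, hb⟩, ⟨c1, hc1, c2, hc2, hc⟩⟩ := hcon
  obtain ⟨⟨g0, hg0⟩, hgen⟩ := hcyc.exists_generator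
  let y : MonoidAlgebra (ZMod p) G := single g0 1 - 1
  have hL : ∀ g ∈ commutator G, ∃ t, single g 1 - 1 = y * t := by
    intro g hg
    obtain ⟨k, hk⟩ := (mem_powers_iff_mem_zpowers.2 (hgen ⟨g, hg⟩))
    have hk : g0 ^ k = g := congrArg Subtype.val hk
    refine ⟨∑ i ∈ Finset.range k, (single g0 1) ^ i, ?_⟩
    rw [mul_geom_sum, single_pow, hk, one_pow]
  have hcomm : ∀ a a' : MonoidAlgebra (ZMod p) G, ∃ t, a * a' - a' * a = y * t := by
    intro a a'
    induction a using MonoidAlgebra.induction_linear with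
    | zero => exact ⟨0, by simp⟩
    | add a1 a2 h1 h2 =>
      obtain ⟨t1, h1⟩ := h1
      obtain ⟨t2, h2⟩ := h2
      exact ⟨t1 + t2, by rw [mul_add y, ← h1, ← h2]; noncomm_ring⟩
    | single g r =>
      induction a' using MonoidAlgebra.induction_linear with
      | zero => exact ⟨0, by simp⟩
      | add a1 a2 h1 h2 =>
        obtain ⟨t1, h1⟩ := h1
        obtain ⟨t2, h2⟩ := h2
        exact ⟨t1 + t2, by rw [mul_add y, ← h1, ← h2]; noncomm_ring⟩
      | single k s =>
        obtain ⟨t, ht⟩ := hL ⁅g, k⁆ (Subgroup.commutator_mem_commutator (Subgroup.mem_top g) (Subgroup.mem_top k))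
        refine ⟨t * single (k * g) (r * s), ?_⟩
        rw [← mul_assoc, ← ht, sub_mul, one_mul, single_mul_single, single_mul_single,
          single_mul_single, commutatorElement_def, one_mul, mul_comm s r]
        congr 2
        group
  have hleft : ∀ a : MonoidAlgebra (ZMod p) G, ∃ t, a * y = y * t := by
    intro a
    obtain ⟨t, ht⟩ := hcomm a y
    exact ⟨t + a, by rw [mul_add, ← ht, sub_add_cancel]⟩
  have hyB : φ y ≠ 0 := by
    intro h0
    obtain ⟨t, ht⟩ := hcomm b1 b2
    apply hb
    have := congrArg φ ht
    rw [map_mul, h0, zero_mul, map_sub, map_mul, map_mul, h.φB _ hb1, h.φB _ hb2, sub_eq_zero] at this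
    exact this
  have hyC : ψ y ≠ 0 := by
    intro h0
    obtain ⟨t, ht⟩ := hcomm c1 c2
    apply hc
    have := congrArg ψ ht
    rw [map_mul, h0, zero_mul, map_sub, map_mul, map_mul, h.ψC _ hc1, h.ψC _ hc2, sub_eq_zero] at this
    exact this
  let T : MonoidAlgebra (ZMod p) G → Prop := fun a => ∃ t, aug p G t = 0 ∧ a = y * t
  have hTadd : ∀ a a', T a → T a' → T (a + a') := by
    rintro _ _ ⟨t, ht, rfl⟩ ⟨s, hs, rfl⟩
    exact ⟨t + s, by simp [ht, hs], by rw [mul_add]⟩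
  have hTr : ∀ a a', T a → T (a * a') := by
    rintro _ a' ⟨t, ht, rfl⟩
    exact ⟨t * a', by simp [ht], by rw [mul_assoc]⟩
  have hTl : ∀ a a', T a → T (a' * a) := by
    rintro _ a' ⟨t, ht, rfl⟩
    obtain ⟨s, hs⟩ := hleft a'
    exact ⟨s * t, by simp [ht], by rw [← mul_assoc, hs, mul_assoc]⟩
  have hTB : ∀ b ∈ B, ∀ b' ∈ B, T (b * b' - b' * b) := by
    intro b hb b' hb'
    obtain ⟨t, ht⟩ := hcomm b b'
    refine ⟨t, ?_, ht⟩
    by_contra hne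
    apply hyC
    refine mul_inj_of_aug hG (ψ t) (by rwa [h.augψ]) _ ?_
    rw [← map_mul, ← ht, map_sub, map_mul, map_mul, h.ψB _ hb, h.ψB _ hb', (Algebra.commutes _ _), sub_self]
  have hTC : ∀ c ∈ C, ∀ c' ∈ C, T (c * c' - c' * c) := by
    intro b hb b' hb'
    obtain ⟨t, ht⟩ := hcomm b b'
    refine ⟨t, ?_, ht⟩
    by_contra hne
    apply hyB
    refine mul_inj_of_aug hG (φ t) (by rwa [h.symm.augψ]) _ ?_
    rw [← map_mul, ← ht, map_sub, map_mul, map_mul, h.φC _ hb, h.φC _ hb', (Algebra.commutes _ _), sub_self]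
  have hTA : ∀ a a', T (a * a' - a' * a) := by
    intro a a'
    refine h.gen (fun a => T (a * a' - a' * a)) ?_ ?_ a
    · intro b hb c hc
      refine h.gen (fun a' => T ((b * c) * a' - a' * (b * c))) ?_ ?_ a'
      · intro b' hb' c' hc'
        have e : b * c * (b' * c') - b' * c' * (b * c)
            = (b * b' - b' * b) * (c * c') + (b' * b) * (c * c' - c' * c) := by
          have e1 : c * b' = b' * c := (h.comm b' hb' c hc).eq.symm
          have e2 : c' * b = b * c' := (h.comm b hb c' hc').eq.symm
          have e3 : b * c * (b' * c') = b * b' * (c * c') := by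
            rw [mul_assoc, ← mul_assoc c, e1]; simp only [mul_assoc]
          have e4 : b' * c' * (b * c) = b' * b * (c' * c) := by
            rw [mul_assoc, ← mul_assoc c', e2]; simp only [mul_assoc]
          rw [e3, e4]; noncomm_ring
        rw [e]
        exact hTadd _ _ (hTr _ _ (hTB b hb b' hb')) (hTl _ _ (hTC c hc c' hc'))
      · intro x z hx hz
        have e : b * c * (x + z) - (x + z) * (b * c)
            = (b * c * x - x * (b * c)) + (b * c * z - z * (b * c)) := by noncomm_ring
        rw [e]; exact hTadd _ _ hx hz
    · intro x z hx hz
      have e : (x + z) * a' - a' * (x + z) = (x * a' - a' * x) + (z * a' - a' * z) := by noncomm_ring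
      rw [e]; exact hTadd _ _ hx hz
  let N : Subgroup G :=
    { carrier := {g | T (single g 1 - 1)}
      one_mem' := ⟨0, by simp, by simp [← one_def]⟩
      mul_mem' := by
        intro a b ha hb
        have e : (single (a * b) 1 - 1 : MonoidAlgebra (ZMod p) G)
            = single a 1 * (single b 1 - 1) + (single a 1 - 1) := by
          rw [mul_sub, single_mul_single]; simp
        change T _
        rw [e]
        exact hTadd _ _ (hTl _ _ hb) ha
      inv_mem' := by
        intro a ha
        have e : (single a⁻¹ 1 - 1 : MonoidAlgebra (ZMod p) G)
            = (- single a⁻¹ 1) * (single a 1 - 1) := by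
          rw [mul_sub, neg_mul, single_mul_single]; simp [one_def]; abel
        change T _
        rw [e]
        exact hTl _ _ ha }
  have hN : commutator G ≤ N := by
    rw [commutator_def, Subgroup.commutator_le]
    intro g _ k _
    change T _
    have e : (single ⁅g, k⁆ 1 - 1 : MonoidAlgebra (ZMod p) G)
        = (single g 1 * single k 1 - single k 1 * single g 1) * single (g⁻¹ * k⁻¹) 1 := by
      rw [sub_mul, single_mul_single, single_mul_single, single_mul_single, single_mul_single,
        commutatorElement_def, one_def]
      congr 2 <;> simp [mul_assoc]
    rw [e]
    exact hTr _ _ (hTA _ _)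
  obtain ⟨t, ht, hyt⟩ : T y := hN hg0
  apply hyB
  have : y = 0 := by
    refine mul_inj_of_aug hG (1 - t) (by simp [ht]) _ ?_
    rw [mul_sub, ← hyt, mul_one, sub_self]
  rw [this, map_zero]

theorem chain_cyclic [Finite G] (hG : IsPGroup p G) (z : G) (hz : ∀ g, g ∈ Subgroup.zpowers z)
    (a b : MonoidAlgebra (ZMod p) G) : (∃ t, a = b * t) ∨ (∃ t, b = a * t) := by
  let x : MonoidAlgebra (ZMod p) G := single z 1 - 1
  have hx0 : aug p G x = 0 := by simp [x]
  obtain ⟨N, hN⟩ := nilp_of_aug hG x hx0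
  have hdiv : ∀ a, ∃ t, a = x * t + algebraMap _ _ (aug p G a) := by
    intro a
    induction a using MonoidAlgebra.induction_linear with
    | zero => exact ⟨0, by simp⟩
    | add a1 a2 h1 h2 =>
      obtain ⟨t1, h1⟩ := h1
      obtain ⟨t2, h2⟩ := h2
      refine ⟨t1 + t2, ?_⟩
      conv_lhs => rw [h1, h2]
      rw [map_add, map_add, mul_add]; abel
    | single g r =>
      obtain ⟨k, hk⟩ := (mem_powers_iff_mem_zpowers.2 (hz g))
      have hk : z ^ k = g := hk
      refine ⟨r • ∑ i ∈ Finset.range k, (single z 1) ^ i, ?_⟩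
      rw [mul_smul_comm, mul_geom_sum, single_pow, hk, one_pow, aug_single, smul_sub, smul_single',
        mul_one, Algebra.algebraMap_eq_smul_one, sub_add_cancel]
  have hfac : ∀ n : ℕ, ∀ a, (∃ i u, i < n ∧ IsUnit u ∧ a = x ^ i * u) ∨ ∃ t, a = x ^ n * t := by
    intro n
    induction n with
    | zero => exact fun a => Or.inr ⟨a, by simp⟩
    | succ n ih =>
      intro a
      rcases ih a with ⟨i, u, hi, hu, h⟩ | ⟨t, ht⟩
      · exact Or.inl ⟨i, u, by omega, hu, h⟩
      · by_cases h0 : aug p G t = 0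
        · obtain ⟨s, hs⟩ := hdiv t
          rw [h0, map_zero, add_zero] at hs
          exact Or.inr ⟨s, by rw [ht, hs, pow_succ, mul_assoc]⟩
        · exact Or.inl ⟨n, t, by omega, isUnit_of_aug hG t h0, ht⟩
  have hfin : ∀ a, (∃ i u, IsUnit u ∧ a = x ^ i * u) ∨ a = 0 := by
    intro a
    rcases hfac N a with ⟨i, u, hi, hu, h⟩ | ⟨t, ht⟩
    · exact Or.inl ⟨i, u, hu, h⟩
    · exact Or.inr (by rw [ht, hN, zero_mul])
  rcases hfin a with ⟨i, u, hu, rfl⟩ | rfl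
  · rcases hfin b with ⟨j, v, hv, rfl⟩ | rfl
    · obtain ⟨u, rfl⟩ := hu
      obtain ⟨v, rfl⟩ := hv
      rcases le_total j i with hij | hij
      · obtain ⟨d, rfl⟩ := Nat.exists_eq_add_of_le hij
        refine Or.inl ⟨(v⁻¹).1 * (x ^ d * u), ?_⟩
        rw [mul_assoc, Units.mul_inv_cancel_left, pow_add, mul_assoc]
      · obtain ⟨d, rfl⟩ := Nat.exists_eq_add_of_le hij
        refine Or.inr ⟨(u⁻¹).1 * (x ^ d * v), ?_⟩
        rw [mul_assoc, Units.mul_inv_cancel_left, pow_add, mul_assoc]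
    · exact Or.inr ⟨0, by simp⟩
  · exact Or.inl ⟨0, by simp⟩

theorem exists_aug_zero (B : Subalgebra (ZMod p) (MonoidAlgebra (ZMod p) G)) (hB : B ≠ ⊥) :
    ∃ b ∈ B, aug p G b = 0 ∧ b ≠ 0 := by
  by_contra! hcon
  apply hB
  rw [eq_bot_iff]
  intro b hb
  have := hcon (b - algebraMap _ _ (aug p G b)) (sub_mem hb (B.algebraMap_mem _))
    (by rw [map_sub, AlgHom.commutes]; simp)
  rw [sub_eq_zero] at this
  rw [this]
  exact (⊥ : Subalgebra (ZMod p) (MonoidAlgebra (ZMod p) G)).algebraMap_mem _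

theorem Fac.final [Finite G] (hG : IsPGroup p G)
    (hindec : ∀ H K : Subgroup G, H.Normal → K.Normal →
      Disjoint H K → H ⊔ K = ⊤ → H = ⊥ ∨ K = ⊥)
    {B C : Subalgebra (ZMod p) (MonoidAlgebra (ZMod p) G)} {φ ψ} (h : Fac B C φ ψ)
    (hB : B ≠ ⊥) (hC : C ≠ ⊥) (hcomm : ∀ c ∈ C, ∀ c' ∈ C, Commute c c') : False := by
  classical
  have hch : CharP (MonoidAlgebra (ZMod p) G) p :=
    charP_of_injective_algebraMap (algebraMap (ZMod p) (MonoidAlgebra (ZMod p) G)).injective p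
  obtain ⟨b, hb, hb0, hbne⟩ := exists_aug_zero B hB
  obtain ⟨c, hc, hc0, hcne⟩ := exists_aug_zero C hC
  have hcent : ∀ c ∈ C, ∀ a, Commute c a := by
    intro c hc a
    refine h.gen (fun a => Commute c a) ?_ ?_ a
    · intro b hb c' hc'
      exact (h.comm b hb c hc).symm.mul_right (hcomm c hc c' hc')
    · intro x y hx hy
      exact hx.add_right hy
  have hex : ∃ n : ℕ, ∀ x ∈ C, aug p G x = 0 → x ^ p ^ n = 0 := by
    obtain ⟨n, hn⟩ := nilp_uniform hG
    exact ⟨n, fun x _ => hn x⟩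
  obtain ⟨m, hm⟩ : ∃ m, Nat.find hex = m + 1 := by
    refine Nat.exists_eq_succ_of_ne_zero fun h0 => ?_
    have := Nat.find_spec hex c hc hc0
    rw [h0, pow_zero, pow_one] at this
    exact hcne this
  have hnil := Nat.find_spec hex
  have hmin := Nat.find_min hex (m := m) (by omega)
  rw [hm] at hnil
  push Not at hmin
  obtain ⟨d, hd, hd0, hdne⟩ := hmin
  obtain ⟨z, hz, hz1, hz2⟩ := exists_central hG ψ
    (fun a b => hcomm _ (h.memψ a) _ (h.memψ b)) d (hcent d hd) m (by rwa [h.ψC d hd])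
    (hnil d hd hd0)
  let χ : G →* (MonoidAlgebra (ZMod p) G)ˣ :=
    ((ψ : MonoidAlgebra (ZMod p) G →* MonoidAlgebra (ZMod p) G).comp
      (MonoidAlgebra.of (ZMod p) G)).toHomUnits
  have hχ : ∀ g, (χ g).1 = ψ (single g 1) := fun g => rfl
  let _inst : CommGroup χ.range :=
    { (inferInstance : Group χ.range) with
      mul_comm := by
        rintro ⟨_, g, rfl⟩ ⟨_, k, rfl⟩
        apply Subtype.ext
        apply Units.ext
        exact hcomm _ (h.memψ (single g 1)) _ (h.memψ (single k 1)) }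
  have hfin : Finite χ.range := Finite.of_surjective _ χ.rangeRestrict_surjective
  have hcyc := split_off hindec χ.rangeRestrict m (by
    rintro ⟨_, g, rfl⟩
    apply Subtype.ext
    apply Units.ext
    change (χ g).1 ^ p ^ (m + 1) = 1
    have := hnil (ψ (single g 1) - 1) (sub_mem (h.memψ _) (one_mem _))
      (by rw [map_sub, h.augψ]; simp)
    rw [sub_pow_char_pow_of_commute _ _ (Commute.one_right _), one_pow, sub_eq_zero] at this
    exact this) z hz hz1 (by
    intro h0
    apply hz2
    exact congrArg (fun t : χ.range => (t.1.1 : MonoidAlgebra (ZMod p) G)) h0)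
  rcases chain_cyclic hG z hcyc b c with ⟨t, ht⟩ | ⟨t, ht⟩
  · apply hbne
    rw [← h.φB b hb, ht, map_mul, h.φC c hc, hc0, map_zero, zero_mul]
  · apply hcne
    rw [← h.ψC c hc, ht, map_mul, h.ψB b hb, hb0, map_zero, zero_mul]

end TF

/-- Let `G` be a finite `p`-group, indecomposable as a direct product of
nontrivial subgroups, whose derived subgroup `G'` is cyclic. Then `F_pG` admits no
tensor factorization `F_pG = B ⊗ C` with `B` and `C` proper subalgebras. -/
theorem stmt19 (p : ℕ) [Fact p.Prime]
    (G : Type*) [Group G] [Finite G] (hG : IsPGroup p G)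
    (hindec : ∀ H K : Subgroup G, H.Normal → K.Normal →
      Disjoint H K → H ⊔ K = ⊤ → H = ⊥ ∨ K = ⊥)
    (hcyc : IsCyclic (commutator G)) :
    ¬∃ B C : Subalgebra (ZMod p) (MonoidAlgebra (ZMod p) G),
      (∀ b ∈ B, ∀ c ∈ C, Commute b c) ∧
      Function.Bijective
        (Submodule.mulMap (Subalgebra.toSubmodule B) (Subalgebra.toSubmodule C)) ∧
      B ≠ ⊥ ∧ C ≠ ⊥ := by
  rintro ⟨B, C, h1, h2, hB, hC⟩
  obtain ⟨φ, ψ, h⟩ := TF.exists_fac B C h1 h2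
  rcases h.comm_or hG hcyc with hc | hc
  · exact h.symm.final hG hindec hC hB hc
  · exact h.final hG hindec hB hC hc
end
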